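/- arXiv:1511.02981 — 4 statements merged into one kernel-verified Lean document; each statement's English description precedes it below -/
import Mathlib

section
/- Let T = (T_1,…,T_d) be a commuting row contraction on a complex Hilbert space H. Then there exists a complex Hilbert space K containing H isometrically, together with a decomposition K = K_1 ⊕ K_2 into two mutually orthogonal closed subspaces, and a commuting row contraction V = (V_1,…,V_d) on K, such that: (i) K_1 and K_2 are reducing for V; (ii) the restriction of V to K_1 is a pure commuting row contraction; (iii) the restriction of V to K_2 is a spherical unitary; and (iv) V is a co-extension of T, i.e. H is co-invariant for V (V_k* H ⊆ H for each k) and T_k* = V_k*|_H for each 1 ≤ k ≤ d. -/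
noncomputable section

open ContinuousLinearMap Filter

namespace RowCtr

variable {H : Type*} [NormedAddCommGroup H] [InnerProductSpace ℂ H] [CompleteSpace H]
variable {d : ℕ}

/-- A pairwise commuting tuple of operators. -/
def Commuting (T : Fin d → H →L[ℂ] H) : Prop := ∀ i j, Commute (T i) (T j)

/-- A commuting row contraction: `∑ Tₖ Tₖ* ≤ 1` in the Loewner order. -/
def IsRowContraction (T : Fin d → H →L[ℂ] H) : Prop :=
  Commuting T ∧ (1 - ∑ k, T k ∘L adjoint (T k)).IsPositive

/-- A spherical unitary: commuting normal operators with `∑ Uₖ Uₖ* = 1`. -/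
def IsSphericalUnitary (U : Fin d → H →L[ℂ] H) : Prop :=
  Commuting U ∧ (∀ k, U k ∘L adjoint (U k) = adjoint (U k) ∘L U k) ∧
    (∑ k, U k ∘L adjoint (U k)) = 1

/-- `T^α = T₁^{α₁} ⋯ T_d^{α_d}`. -/
def mpow (T : Fin d → H →L[ℂ] H) (α : Fin d → ℕ) : H →L[ℂ] H :=
  (List.ofFn fun i => T i ^ α i).prod

/-- `∑_{|α| = N} (N!/α!) ‖T^{*α} ξ‖²`. -/
def defectSum (T : Fin d → H →L[ℂ] H) (N : ℕ) (ξ : H) : ℝ :=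
  ∑ α ∈ Finset.Nat.antidiagonalTuple d N,
    (Nat.multinomial Finset.univ α : ℝ) * ‖adjoint (mpow T α) ξ‖ ^ 2

/-- A pure row contraction. -/
def IsPure (T : Fin d → H →L[ℂ] H) : Prop :=
  ∀ ξ : H, Tendsto (fun N => defectSum T N ξ) atTop (nhds 0)

/-- `N` is invariant under every `T k`. -/
def Invar (T : Fin d → H →L[ℂ] H) (N : Submodule ℂ H) : Prop :=
  ∀ k, ∀ x ∈ N, T k x ∈ N

/-- `N` is reducing for the tuple `T`. -/
def Reduces (T : Fin d → H →L[ℂ] H) (N : Submodule ℂ H) : Prop :=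
  Invar T N ∧ ∀ k, ∀ x ∈ N, adjoint (T k) x ∈ N

/-- Restriction of an operator to an invariant subspace. -/
def restrictCLM (f : H →L[ℂ] H) (N : Submodule ℂ H) (h : ∀ x ∈ N, f x ∈ N) :
    N →L[ℂ] N where
  toLinearMap := f.toLinearMap.restrict h
  cont := (f.continuous.comp continuous_subtype_val).subtype_mk _

/-- Restriction of a tuple to a common invariant subspace. -/
def restrictTuple (T : Fin d → H →L[ℂ] H) (N : Submodule ℂ H) (h : Invar T N) :
    Fin d → N →L[ℂ] N := fun k => restrictCLM (T k) N (h k)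

/-- `N` is a closed invariant subspace on which `T` restricts to a spherical unitary. -/
def RestrictsToSphericalUnitary (T : Fin d → H →L[ℂ] H) (N : Submodule ℂ H) : Prop :=
  ∃ (hc : IsClosed (N : Set H)) (hi : Invar T N),
    letI : CompleteSpace N := hc.completeSpace_coe
    IsSphericalUnitary (restrictTuple T N hi)

/-- A completely non-unitary tuple. -/
def IsCompletelyNonUnitary (T : Fin d → H →L[ℂ] H) : Prop :=
  ∀ N : Submodule ℂ H, RestrictsToSphericalUnitary T N → N = ⊥

end RowCtr

namespace RowCtr

open scoped InnerProductSpace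

universe u

/-- A co-extension of the tuple `T` to a direct sum of a pure commuting row contraction and a
spherical unitary: a Hilbert space `K` containing `H` isometrically, an orthogonal decomposition
`K = K₁ ⊕ K₂` into closed reducing subspaces for a commuting row contraction `V` on `K` which
restricts to a pure tuple on `K₁` and to a spherical unitary on `K₂`, such that the (image of)
`H` is co-invariant for `V` and `Tₖ* = Vₖ*|_H` for each `k`. -/
structure PureSphericalCoextension {H : Type u} [NormedAddCommGroup H]
    [InnerProductSpace ℂ H] [CompleteSpace H] {d : ℕ} (T : Fin d → H →L[ℂ] H) where
  K : Type u
  [nacg : NormedAddCommGroup K]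
  [ips : InnerProductSpace ℂ K]
  [cpl : CompleteSpace K]
  /-- The isometric inclusion of `H` in `K`. -/
  emb : H →ₗᵢ[ℂ] K
  K₁ : Submodule ℂ K
  K₂ : Submodule ℂ K
  hK₁ : IsClosed (K₁ : Set K)
  hK₂ : IsClosed (K₂ : Set K)
  orth : ∀ x ∈ K₁, ∀ y ∈ K₂, ⟪x, y⟫_ℂ = 0
  compl : K₁ ⊔ K₂ = ⊤
  /-- The dilated tuple. -/
  V : Fin d → K →L[ℂ] K
  hV : IsRowContraction V
  red₁ : Reduces V K₁
  red₂ : Reduces V K₂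
  pure₁ : letI : CompleteSpace K₁ := hK₁.completeSpace_coe
          IsPure (restrictTuple V K₁ red₁.1)
  su₂ : letI : CompleteSpace K₂ := hK₂.completeSpace_coe
        IsSphericalUnitary (restrictTuple V K₂ red₂.1)
  /-- The image of `H` is co-invariant for `V`. -/
  coinv : ∀ (k : Fin d) (ξ : H),
    ContinuousLinearMap.adjoint (V k) (emb ξ) ∈ LinearMap.range emb.toLinearMap
  /-- `Tₖ* = Vₖ*|_H`. -/
  coext : ∀ (k : Fin d) (ξ : H),
    ContinuousLinearMap.adjoint (V k) (emb ξ) = emb (ContinuousLinearMap.adjoint (T k) ξ)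

section Completion

theorem exists_hilbert_completion {X : Type u} [AddCommGroup X] [Module ℂ X]
    (c : PreInnerProductSpace.Core ℂ X) :
    ∃ (K : Type u) (_ : NormedAddCommGroup K) (_ : InnerProductSpace ℂ K) (_ : CompleteSpace K)
      (ι : X →ₗ[ℂ] K), DenseRange ι ∧ ∀ x y, ⟪ι x, ι y⟫_ℂ = c.inner x y := by
  let _ : SeminormedAddCommGroup X := @InnerProductSpace.Core.toSeminormedAddCommGroup ℂ X _ _ _ c
  let _ : InnerProductSpace ℂ X := InnerProductSpace.ofCore c
  refine ⟨UniformSpace.Completion X, inferInstance, inferInstance, inferInstance,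
    (UniformSpace.Completion.toComplₗᵢ (𝕜 := ℂ) (E := X)).toLinearMap,
    UniformSpace.Completion.denseRange_coe, fun x y => ?_⟩
  exact UniformSpace.Completion.inner_coe x y

theorem exists_clm_of_formal_adjoint {X K : Type*} [AddCommGroup X] [Module ℂ X]
    [NormedAddCommGroup K] [InnerProductSpace ℂ K] [CompleteSpace K]
    {ι : X →ₗ[ℂ] K} (hι : DenseRange ι) {A B : X →ₗ[ℂ] X}
    (hAB : ∀ x y, ⟪ι (A x), ι y⟫_ℂ = ⟪ι x, ι (B y)⟫_ℂ) (hB : ∀ x, ‖ι (B x)‖ ≤ ‖ι x‖) :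
    ∃ V : K →L[ℂ] K, (∀ x, V (ι x) = ι (A x)) ∧ ∀ x, adjoint V (ι x) = ι (B x) := by
  have hC : ∃ C : ℝ, ∀ x, ‖(ι ∘ₗ B) x‖ ≤ C * ‖ι x‖ := ⟨1, fun x => by simpa using hB x⟩
  have hext := fun x => LinearMap.extendOfNorm_eq hι hC x
  set W := (ι ∘ₗ B).extendOfNorm ι
  refine ⟨adjoint W, fun x => ?_, fun x => by simpa using hext x⟩
  refine hι.eq_of_inner_left ℂ fun y => ?_
  rw [adjoint_inner_left, hext, LinearMap.comp_apply, hAB]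

end Completion

section WeightedSequences

variable {E : Type*} [NormedAddCommGroup E] [InnerProductSpace ℂ E] {e : ℕ}

theorem sum_add_single (α : Fin e → ℕ) (k : Fin e) :
    ∑ i, (α + Pi.single k 1 : Fin e → ℕ) i = ∑ i, α i + 1 := by
  simp [Finset.sum_add_distrib, Finset.sum_pi_single']

theorem multinomial_add_single (α : Fin e → ℕ) (k : Fin e) :
    Nat.multinomial Finset.univ (α + Pi.single k 1) * (α k + 1) =
      Nat.multinomial Finset.univ α * (∑ i, α i + 1) := by
  have hp : ∏ i, ((α + Pi.single k 1 : Fin e → ℕ) i).factorial =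
      (α k + 1) * ∏ i, (α i).factorial := by
    rw [← Finset.mul_prod_erase _ _ (Finset.mem_univ k),
      ← Finset.mul_prod_erase _ (fun i => (α i).factorial) (Finset.mem_univ k), ← mul_assoc]
    congr 1
    · simp [Nat.factorial_succ]
    · refine Finset.prod_congr rfl fun i hi => ?_
      simp [Pi.single_eq_of_ne (Finset.ne_of_mem_erase hi)]
  have h1 := Nat.multinomial_spec Finset.univ (α + Pi.single k 1)
  have h2 := Nat.multinomial_spec Finset.univ α
  rw [sum_add_single, hp, Nat.factorial_succ, ← h2] at h1
  refine Nat.eq_of_mul_eq_mul_left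
    (Finset.prod_pos fun i _ => Nat.factorial_pos (α i) : 0 < ∏ i, (α i).factorial) ?_
  linarith

/-- The weighted inner product of the homogeneous components of degree `N`. -/
def levelInner (N : ℕ) (x y : (Fin e → ℕ) → E) : ℂ :=
  ∑ α ∈ Finset.Nat.antidiagonalTuple e N, (Nat.multinomial Finset.univ α : ℂ) * ⟪x α, y α⟫_ℂ

/-- The weighted square norm of the homogeneous component of degree `N`. -/
def levelNormSq (N : ℕ) (x : (Fin e → ℕ) → E) : ℝ :=
  ∑ α ∈ Finset.Nat.antidiagonalTuple e N, (Nat.multinomial Finset.univ α : ℝ) * ‖x α‖ ^ 2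

/-- The backward shift in the `k`-th variable. -/
def backwardShift (k : Fin e) : ((Fin e → ℕ) → E) →ₗ[ℂ] ((Fin e → ℕ) → E) where
  toFun x α := x (α + Pi.single k 1)
  map_add' _ _ := rfl
  map_smul' _ _ := rfl

/-- The formal adjoint of the backward shift in the `k`-th variable. -/
def forwardShift (k : Fin e) : ((Fin e → ℕ) → E) →ₗ[ℂ] ((Fin e → ℕ) → E) where
  toFun x β := ((β k : ℂ) / ((∑ i, β i : ℕ) : ℂ)) • x (β - Pi.single k 1)
  map_add' _ _ := by ext; simp
  map_smul' c x := by ext β; exact smul_comm _ c (x _)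

theorem backwardShift_apply (k : Fin e) (x : (Fin e → ℕ) → E) (α : Fin e → ℕ) :
    backwardShift k x α = x (α + Pi.single k 1) := rfl

theorem forwardShift_apply (k : Fin e) (x : (Fin e → ℕ) → E) (β : Fin e → ℕ) :
    forwardShift k x β = ((β k : ℂ) / ((∑ i, β i : ℕ) : ℂ)) • x (β - Pi.single k 1) := rfl

theorem sub_single_add_single {β : Fin e → ℕ} {k : Fin e} (h : β k ≠ 0) :
    β - Pi.single k 1 + Pi.single k 1 = β := by
  ext i
  rcases eq_or_ne i k with rfl | hi
  · simp only [Pi.add_apply, Pi.sub_apply, Pi.single_eq_same]; omega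
  · simp [hi]

theorem levelInner_self (N : ℕ) (x : (Fin e → ℕ) → E) :
    levelInner N x x = (levelNormSq N x : ℂ) := by
  simp [levelInner, levelNormSq, inner_self_eq_norm_sq_to_K]

theorem levelNormSq_nonneg {E : Type*} [NormedAddCommGroup E] (N : ℕ) (x : (Fin e → ℕ) → E) :
    0 ≤ levelNormSq N x :=
  Finset.sum_nonneg fun _ _ => by positivity

theorem norm_levelInner_le (N : ℕ) (x y : (Fin e → ℕ) → E) :
    ‖levelInner N x y‖ ≤ levelNormSq N x + levelNormSq N y := by
  refine (norm_sum_le _ _).trans ?_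
  rw [levelNormSq, levelNormSq, ← Finset.sum_add_distrib]
  refine Finset.sum_le_sum fun α _ => ?_
  rw [norm_mul, Complex.norm_natCast, ← mul_add]
  refine mul_le_mul_of_nonneg_left ?_ (Nat.cast_nonneg _)
  nlinarith [norm_inner_le_norm (𝕜 := ℂ) (x α) (y α), sq_nonneg (‖x α‖ - ‖y α‖),
    sq_nonneg ‖x α‖, sq_nonneg ‖y α‖]

theorem levelNormSq_add_le {E : Type*} [NormedAddCommGroup E] (N : ℕ) (x y : (Fin e → ℕ) → E) :
    levelNormSq N (x + y) ≤ 2 * (levelNormSq N x + levelNormSq N y) := by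
  rw [levelNormSq, levelNormSq, levelNormSq, ← Finset.sum_add_distrib, Finset.mul_sum]
  refine Finset.sum_le_sum fun α _ => ?_
  have h : ‖(x + y) α‖ ^ 2 ≤ 2 * (‖x α‖ ^ 2 + ‖y α‖ ^ 2) := by
    have h' : ‖(x + y) α‖ ≤ ‖x α‖ + ‖y α‖ := norm_add_le _ _
    nlinarith [pow_le_pow_left₀ (norm_nonneg _) h' 2, sq_nonneg (‖x α‖ - ‖y α‖)]
  nlinarith [mul_le_mul_of_nonneg_left h
    (Nat.cast_nonneg (α := ℝ) (Nat.multinomial Finset.univ α))]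

theorem levelNormSq_smul (N : ℕ) (c : ℂ) (x : (Fin e → ℕ) → E) :
    levelNormSq N (c • x) = ‖c‖ ^ 2 * levelNormSq N x := by
  rw [levelNormSq, levelNormSq, Finset.mul_sum]
  refine Finset.sum_congr rfl fun α _ => ?_
  rw [Pi.smul_apply, norm_smul]
  ring

theorem levelInner_add_left (N : ℕ) (x y z : (Fin e → ℕ) → E) :
    levelInner N (x + y) z = levelInner N x z + levelInner N y z := by
  simp [levelInner, mul_add, Finset.sum_add_distrib]

theorem levelInner_smul_left (N : ℕ) (c : ℂ) (x y : (Fin e → ℕ) → E) :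
    levelInner N (c • x) y = starRingEnd ℂ c * levelInner N x y := by
  simp_rw [levelInner, Finset.mul_sum, Pi.smul_apply, inner_smul_left, mul_left_comm]

theorem conj_levelInner (N : ℕ) (x y : (Fin e → ℕ) → E) :
    starRingEnd ℂ (levelInner N y x) = levelInner N x y := by
  simp [levelInner]

theorem levelInner_zero_forwardShift (k : Fin e) (x y : (Fin e → ℕ) → E) :
    levelInner 0 (forwardShift k x) y = 0 := by
  refine Finset.sum_eq_zero fun α hα => ?_
  rw [Finset.Nat.mem_antidiagonalTuple] at hα
  simp [forwardShift_apply, hα]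

theorem levelInner_succ_forwardShift (N : ℕ) (k : Fin e) (x y : (Fin e → ℕ) → E) :
    levelInner (N + 1) (forwardShift k x) y = levelInner N x (backwardShift k y) := by
  symm
  refine Finset.sum_of_injOn (fun α => α + Pi.single k 1)
    (fun a _ b _ h => add_right_cancel h) (fun α hα => ?_) (fun β hβ hβ' => ?_) fun α hα => ?_
  · simp only [Finset.mem_coe, Finset.Nat.mem_antidiagonalTuple] at hα ⊢
    simp [Finset.sum_add_distrib, Finset.sum_pi_single', hα]
  · rw [Finset.Nat.mem_antidiagonalTuple] at hβ
    suffices h : β k = 0 by simp [forwardShift_apply, h]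
    by_contra h
    refine hβ' ⟨β - Pi.single k 1, ?_, sub_single_add_single h⟩
    rw [Finset.mem_coe, Finset.Nat.mem_antidiagonalTuple]
    have := congrArg (fun γ => ∑ i, γ i) (sub_single_add_single h)
    simp only [Pi.add_apply, Finset.sum_add_distrib, Finset.sum_pi_single', Finset.mem_univ,
      if_true] at this
    omega
  · rw [Finset.Nat.mem_antidiagonalTuple] at hα
    have hm := congrArg (Nat.cast (R := ℂ)) (multinomial_add_single α k)
    rw [hα] at hm
    push_cast at hm
    rw [forwardShift_apply, sum_add_single, hα, add_tsub_cancel_right, inner_smul_left,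
      backwardShift_apply, ← mul_assoc]
    congr 1
    have : (N : ℂ) + 1 ≠ 0 := by exact_mod_cast N.succ_ne_zero
    simp only [map_div₀, Complex.conj_natCast, Pi.add_apply, Pi.single_eq_same]
    push_cast
    field_simp
    linear_combination -hm

theorem sum_forwardShift_backwardShift (x : (Fin e → ℕ) → E) {β : Fin e → ℕ}
    (hβ : ∑ i, β i ≠ 0) : ∑ k, forwardShift k (backwardShift k x) β = x β := by
  have h : ∀ k, forwardShift k (backwardShift k x) β =
      ((β k : ℂ) / ((∑ i, β i : ℕ) : ℂ)) • x β := by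
    intro k
    rw [forwardShift_apply, backwardShift_apply]
    rcases eq_or_ne (β k) 0 with h0 | h0
    · simp [h0]
    · rw [sub_single_add_single h0]
  have hβ' : ((∑ i, β i : ℕ) : ℂ) ≠ 0 := by exact_mod_cast hβ
  rw [Finset.sum_congr rfl fun k _ => h k, ← Finset.sum_smul, ← Finset.sum_div, ← Nat.cast_sum,
    div_self hβ', one_smul]

theorem sum_levelNormSq_backwardShift (N : ℕ) (x : (Fin e → ℕ) → E) :
    ∑ k, levelNormSq N (backwardShift k x) = levelNormSq (N + 1) x := by
  have h : ∑ k, levelInner N (backwardShift k x) (backwardShift k x) = levelInner (N + 1) x x := by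
    simp_rw [← levelInner_succ_forwardShift, levelInner]
    rw [Finset.sum_comm]
    refine Finset.sum_congr rfl fun α hα => ?_
    rw [Finset.Nat.mem_antidiagonalTuple] at hα
    rw [← Finset.mul_sum, ← sum_inner, sum_forwardShift_backwardShift x (by omega)]
  simp_rw [levelInner_self] at h
  exact_mod_cast h

theorem levelNormSq_backwardShift_le (N : ℕ) (k : Fin e) (x : (Fin e → ℕ) → E) :
    levelNormSq N (backwardShift k x) ≤ levelNormSq (N + 1) x := by
  rw [← sum_levelNormSq_backwardShift]
  exact Finset.single_le_sum (f := fun k => levelNormSq N (backwardShift k x))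
    (fun k _ => levelNormSq_nonneg N _) (Finset.mem_univ k)

theorem levelNormSq_zero_forwardShift (k : Fin e) (x : (Fin e → ℕ) → E) :
    levelNormSq 0 (forwardShift k x) = 0 := by
  have h := levelInner_self 0 (forwardShift k x)
  rw [levelInner_zero_forwardShift] at h
  exact_mod_cast h.symm

theorem levelNormSq_le_of_norm_le {E : Type*} [NormedAddCommGroup E] (N : ℕ)
    {x y : (Fin e → ℕ) → E} {c : ℝ}
    (h : ∀ α, ∑ i, α i = N → ‖x α‖ ≤ c * ‖y α‖) :
    levelNormSq N x ≤ c ^ 2 * levelNormSq N y := by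
  rw [levelNormSq, levelNormSq, Finset.mul_sum]
  refine Finset.sum_le_sum fun α hα => ?_
  rw [Finset.Nat.mem_antidiagonalTuple] at hα
  rw [mul_left_comm, ← mul_pow]
  gcongr
  exact h α hα

theorem backwardShift_forwardShift_apply (k : Fin e) (x : (Fin e → ℕ) → E) (α : Fin e → ℕ) :
    backwardShift k (forwardShift k x) α =
      (((α k : ℝ) + 1) / (((∑ i, α i : ℕ) : ℝ) + 1)) • x α := by
  rw [backwardShift_apply, forwardShift_apply, sum_add_single, add_tsub_cancel_right,
    ← Complex.coe_smul]
  simp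

theorem forwardShift_backwardShift_apply (k : Fin e) (x : (Fin e → ℕ) → E) (α : Fin e → ℕ) :
    forwardShift k (backwardShift k x) α =
      ((α k : ℝ) / ((∑ i, α i : ℕ) : ℝ)) • x α := by
  rw [forwardShift_apply, backwardShift_apply, ← Complex.coe_smul]
  rcases eq_or_ne (α k) 0 with h0 | h0
  · simp [h0]
  · rw [sub_single_add_single h0]
    simp

theorem levelNormSq_succ_forwardShift_le (N : ℕ) (k : Fin e) (x : (Fin e → ℕ) → E) :
    levelNormSq (N + 1) (forwardShift k x) ≤ levelNormSq N x := by
  have h := levelInner_succ_forwardShift N k x (forwardShift k x)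
  rw [levelInner_self, levelInner] at h
  have h' : levelNormSq (N + 1) (forwardShift k x) =
      ∑ α ∈ Finset.Nat.antidiagonalTuple e N, (Nat.multinomial Finset.univ α : ℝ) *
        ((((α k : ℝ) + 1) / (((∑ i, α i : ℕ) : ℝ) + 1)) * ‖x α‖ ^ 2) := by
    rw [← Complex.ofReal_inj, h]
    push_cast
    refine Finset.sum_congr rfl fun α _ => ?_
    rw [backwardShift_forwardShift_apply, ← Complex.coe_smul, inner_smul_right,
      inner_self_eq_norm_sq_to_K]
    simp
  rw [h', levelNormSq]
  refine Finset.sum_le_sum fun α _ => ?_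
  refine mul_le_mul_of_nonneg_left (mul_le_of_le_one_left (by positivity) ?_) (Nat.cast_nonneg _)
  rw [div_le_one (by positivity)]
  have : α k ≤ ∑ i, α i := Finset.single_le_sum (fun _ _ => Nat.zero_le _) (Finset.mem_univ k)
  exact_mod_cast Nat.succ_le_succ this

theorem levelNormSq_selfCommutator_le (N : ℕ) (k : Fin e) (x : (Fin e → ℕ) → E) :
    levelNormSq N (forwardShift k (backwardShift k x) - backwardShift k (forwardShift k x)) ≤
      (1 / ((N : ℝ) + 1)) * levelNormSq N x := by
  have hN : (0 : ℝ) < (N : ℝ) + 1 := by positivity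
  refine (levelNormSq_le_of_norm_le N (y := x) (c := 1 / ((N : ℝ) + 1))
    fun α hα => ?_).trans ?_
  · rw [Pi.sub_apply, forwardShift_backwardShift_apply, backwardShift_forwardShift_apply, hα,
      ← sub_smul, norm_smul]
    gcongr
    have hk : α k ≤ N := hα ▸
      Finset.single_le_sum (fun _ _ => Nat.zero_le _) (Finset.mem_univ k)
    rcases Nat.eq_zero_or_pos N with rfl | hpos
    · simp [Nat.le_zero.mp hk]
    · have hpos' : (0 : ℝ) < N := by exact_mod_cast hpos
      have hk' : (α k : ℝ) ≤ N := by exact_mod_cast hk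
      have : (α k : ℝ) / N - (α k + 1) / (N + 1) = -((N - α k) / N * (1 / (N + 1))) := by
        field_simp
        ring
      rw [this, norm_neg, norm_mul, Real.norm_of_nonneg (by positivity : 0 ≤ 1 / ((N : ℝ) + 1)),
        Real.norm_of_nonneg (div_nonneg (sub_nonneg.mpr hk') hpos'.le)]
      refine mul_le_of_le_one_left (by positivity) ?_
      rw [div_le_one hpos']
      linarith [Nat.cast_nonneg (α := ℝ) (α k)]
  · refine mul_le_mul_of_nonneg_right ?_ (levelNormSq_nonneg N x)
    have : 1 / ((N : ℝ) + 1) ≤ 1 := by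
      rw [div_le_one hN]
      linarith [Nat.cast_nonneg (α := ℝ) N]
    exact pow_le_of_le_one (by positivity) this two_ne_zero

end WeightedSequences

section ShiftModel

variable {E : Type*} [NormedAddCommGroup E] [InnerProductSpace ℂ E] {e : ℕ} {w : ℕ → ℝ}

/-- The weights for which averaging the level inner products is asymptotically shift invariant. -/
structure IsShiftWeight (w : ℕ → ℝ) : Prop where
  nonneg : ∀ n, 0 ≤ w n
  antitone : ∀ n, w (n + 1) ≤ w n
  doubling : ∀ n, w n ≤ 2 * w (n + 1)

/-- The `n`-th weighted partial sum of the level inner products. -/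
def partialInner (w : ℕ → ℝ) (n : ℕ) (x y : (Fin e → ℕ) → E) : ℂ :=
  (w n : ℂ) * ∑ N ∈ Finset.range n, levelInner N x y

/-- The `n`-th weighted partial sum of the level square norms. -/
def partialNormSq (w : ℕ → ℝ) (n : ℕ) (x : (Fin e → ℕ) → E) : ℝ :=
  w n * ∑ N ∈ Finset.range n, levelNormSq N x

theorem partialInner_self (n : ℕ) (x : (Fin e → ℕ) → E) :
    partialInner w n x x = (partialNormSq w n x : ℂ) := by
  simp [partialInner, partialNormSq, levelInner_self]

theorem norm_partialInner_le (hw : IsShiftWeight w) (n : ℕ) (x y : (Fin e → ℕ) → E) :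
    ‖partialInner w n x y‖ ≤ partialNormSq w n x + partialNormSq w n y := by
  rw [partialInner, norm_mul, Complex.norm_real, Real.norm_of_nonneg (hw.nonneg n), partialNormSq,
    partialNormSq, ← mul_add, ← Finset.sum_add_distrib]
  refine mul_le_mul_of_nonneg_left ?_ (hw.nonneg n)
  exact (norm_sum_le _ _).trans (Finset.sum_le_sum fun N _ => norm_levelInner_le N x y)

/-- The families whose weighted partial sums are bounded and whose last summand is negligible. -/
def weightedSpace (hw : IsShiftWeight w) (e : ℕ) (E : Type*) [NormedAddCommGroup E]
    [InnerProductSpace ℂ E] : Submodule ℂ ((Fin e → ℕ) → E) where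
  carrier := {x | (∃ C, ∀ n, partialNormSq w n x ≤ C) ∧
    Tendsto (fun n => w n * levelNormSq n x) atTop (nhds 0)}
  add_mem' := by
    rintro x y ⟨⟨C, hC⟩, hx⟩ ⟨⟨D, hD⟩, hy⟩
    refine ⟨⟨2 * (C + D), fun n => ?_⟩, ?_⟩
    · refine le_trans ?_ (mul_le_mul_of_nonneg_left (add_le_add (hC n) (hD n)) zero_le_two)
      rw [partialNormSq, partialNormSq, partialNormSq, ← mul_add, mul_left_comm,
        ← Finset.sum_add_distrib]
      refine mul_le_mul_of_nonneg_left ?_ (hw.nonneg n)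
      rw [Finset.mul_sum]
      exact Finset.sum_le_sum fun N _ => levelNormSq_add_le N x y
    · refine squeeze_zero (fun n => mul_nonneg (hw.nonneg n) (levelNormSq_nonneg n _))
        (fun n => ?_) (by simpa using (hx.add hy).const_mul 2)
      rw [← mul_add, mul_left_comm]
      exact mul_le_mul_of_nonneg_left (levelNormSq_add_le n x y) (hw.nonneg n)
  zero_mem' := by
    have h : ∀ n, levelNormSq n (0 : (Fin e → ℕ) → E) = 0 := fun n => by simp [levelNormSq]
    exact ⟨⟨0, fun n => by simp [partialNormSq, h]⟩, by simp [h]⟩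
  smul_mem' := by
    rintro c x ⟨⟨C, hC⟩, hx⟩
    refine ⟨⟨‖c‖ ^ 2 * C, fun n => ?_⟩, ?_⟩
    · refine le_trans (le_of_eq ?_) (mul_le_mul_of_nonneg_left (hC n) (sq_nonneg ‖c‖))
      simp_rw [partialNormSq, levelNormSq_smul, ← Finset.mul_sum]
      ring
    · have h := hx.const_mul (‖c‖ ^ 2)
      rw [mul_zero] at h
      exact h.congr fun n => by rw [levelNormSq_smul, mul_left_comm]

theorem sum_range_levelNormSq_backwardShift_le (n : ℕ) (k : Fin e) (x : (Fin e → ℕ) → E) :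
    ∑ N ∈ Finset.range n, levelNormSq N (backwardShift k x) ≤
      ∑ N ∈ Finset.range (n + 1), levelNormSq N x := by
  rw [Finset.sum_range_succ']
  exact (Finset.sum_le_sum fun N _ => levelNormSq_backwardShift_le N k x).trans
    (le_add_of_nonneg_right (levelNormSq_nonneg 0 x))

theorem backwardShift_mem (hw : IsShiftWeight w) (k : Fin e) :
    ∀ x ∈ weightedSpace hw e E, backwardShift k x ∈ weightedSpace hw e E := by
  rintro x ⟨⟨C, hC⟩, hx⟩
  refine ⟨⟨2 * C, fun n => ?_⟩, ?_⟩
  · refine le_trans ?_ (mul_le_mul_of_nonneg_left (hC (n + 1)) zero_le_two)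
    rw [partialNormSq, partialNormSq, ← mul_assoc]
    exact mul_le_mul (hw.doubling n) (sum_range_levelNormSq_backwardShift_le n k x)
      (Finset.sum_nonneg fun N _ => levelNormSq_nonneg N _)
      (mul_nonneg zero_le_two (hw.nonneg _))
  · refine squeeze_zero (fun n => mul_nonneg (hw.nonneg n) (levelNormSq_nonneg n _))
      (fun n => ?_) (by simpa using ((tendsto_add_atTop_iff_nat 1).mpr hx).const_mul 2)
    rw [← mul_assoc]
    exact mul_le_mul (hw.doubling n) (levelNormSq_backwardShift_le n k x)
      (levelNormSq_nonneg _ _) (mul_nonneg zero_le_two (hw.nonneg _))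

theorem forwardShift_mem (hw : IsShiftWeight w) (k : Fin e) :
    ∀ x ∈ weightedSpace hw e E, forwardShift k x ∈ weightedSpace hw e E := by
  rintro x ⟨⟨C, hC⟩, hx⟩
  refine ⟨⟨C, fun n => ?_⟩, ?_⟩
  · cases n with
    | zero => simpa [partialNormSq] using hC 0
    | succ n =>
      refine le_trans ?_ (hC n)
      rw [partialNormSq, partialNormSq, Finset.sum_range_succ', levelNormSq_zero_forwardShift,
        add_zero]
      exact mul_le_mul (hw.antitone n)
        (Finset.sum_le_sum fun N _ => levelNormSq_succ_forwardShift_le N k x)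
        (Finset.sum_nonneg fun N _ => levelNormSq_nonneg _ _) (hw.nonneg n)
  · refine (tendsto_add_atTop_iff_nat 1).mp
      (squeeze_zero (fun n => mul_nonneg (hw.nonneg _) (levelNormSq_nonneg _ _)) (fun n => ?_) hx)
    exact mul_le_mul (hw.antitone n) (levelNormSq_succ_forwardShift_le n k x)
      (levelNormSq_nonneg _ _) (hw.nonneg n)

/-- The backward shift on `weightedSpace`. -/
def weightedBackwardShift (hw : IsShiftWeight w) (k : Fin e) :
    weightedSpace hw e E →ₗ[ℂ] weightedSpace hw e E :=
  (backwardShift k).restrict (backwardShift_mem hw k)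

/-- The forward shift on `weightedSpace`. -/
def weightedForwardShift (hw : IsShiftWeight w) (k : Fin e) :
    weightedSpace hw e E →ₗ[ℂ] weightedSpace hw e E :=
  (forwardShift k).restrict (forwardShift_mem hw k)

theorem coe_weightedBackwardShift (hw : IsShiftWeight w) (k : Fin e)
    (x : weightedSpace hw e E) :
    (weightedBackwardShift hw k x : (Fin e → ℕ) → E) = backwardShift k x := rfl

theorem coe_weightedForwardShift (hw : IsShiftWeight w) (k : Fin e)
    (x : weightedSpace hw e E) :
    (weightedForwardShift hw k x : (Fin e → ℕ) → E) = forwardShift k x := rfl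

/-- A Hilbert space completing `weightedSpace` for a generalized limit of the weighted partial
sums, with the operators induced by the shifts. -/
structure IsShiftModel (hw : IsShiftWeight w) {K : Type*} [NormedAddCommGroup K]
    [InnerProductSpace ℂ K] [CompleteSpace K] (ι : weightedSpace hw e E →ₗ[ℂ] K)
    (V : Fin e → K →L[ℂ] K) : Prop where
  denseRange : DenseRange ι
  tendsto_inner : ∀ x y : weightedSpace hw e E,
    Tendsto (fun n => partialInner w n (x : (Fin e → ℕ) → E) y) (hyperfilter ℕ : Filter ℕ)
      (nhds ⟪ι x, ι y⟫_ℂ)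
  apply_eq : ∀ k x, V k (ι x) = ι (weightedForwardShift hw k x)
  adjoint_apply_eq : ∀ k x,
    adjoint (V k) (ι x) = ι (weightedBackwardShift hw k x)

theorem exists_tendsto_hyperfilter {f : ℕ → ℂ} {C : ℝ} (h : ∀ n, ‖f n‖ ≤ C) :
    ∃ c, Tendsto f (hyperfilter ℕ : Filter ℕ) (nhds c) := by
  obtain ⟨c, -, hc⟩ := (isCompact_closedBall (0 : ℂ) C).ultrafilter_le_nhds'
    ((hyperfilter ℕ).map f) (Eventually.of_forall (f := (hyperfilter ℕ : Filter ℕ))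
      fun n => by simpa using h n)
  exact ⟨c, hc⟩

theorem partialInner_backwardShift (n : ℕ) (k : Fin e) (x y : (Fin e → ℕ) → E) :
    partialInner w n x (backwardShift k y) =
      partialInner w n (forwardShift k x) y + w n * levelInner n (forwardShift k x) y := by
  rw [partialInner, partialInner, ← mul_add, ← Finset.sum_range_succ, Finset.sum_range_succ',
    levelInner_zero_forwardShift, add_zero]
  simp_rw [levelInner_succ_forwardShift]

theorem partialNormSq_backwardShift_le (hw : IsShiftWeight w) (n : ℕ) (k : Fin e)
    (x : (Fin e → ℕ) → E) :
    partialNormSq w n (backwardShift k x) ≤ partialNormSq w n x + w n * levelNormSq n x := by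
  rw [partialNormSq, partialNormSq, ← mul_add, ← Finset.sum_range_succ]
  exact mul_le_mul_of_nonneg_left (sum_range_levelNormSq_backwardShift_le n k x) (hw.nonneg n)

theorem tendsto_weight_mul_levelInner (hw : IsShiftWeight w) (x y : weightedSpace hw e E) :
    Tendsto (fun n => (w n : ℂ) * levelInner n (x : (Fin e → ℕ) → E) y) atTop (nhds 0) := by
  refine squeeze_zero_norm (fun n => ?_) (by simpa using x.2.2.add y.2.2)
  rw [norm_mul, Complex.norm_real, Real.norm_of_nonneg (hw.nonneg n), ← mul_add]
  exact mul_le_mul_of_nonneg_left (norm_levelInner_le n _ _) (hw.nonneg n)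

theorem tendsto_partialNormSq_of_tendsto_partialInner {K : Type*} [NormedAddCommGroup K]
    [InnerProductSpace ℂ K] {l : Filter ℕ} {x : (Fin e → ℕ) → E} {v : K}
    (h : Tendsto (fun n => partialInner w n x x) l (nhds ⟪v, v⟫_ℂ)) :
    Tendsto (fun n => partialNormSq w n x) l (nhds (‖v‖ ^ 2)) := by
  have h' := (Complex.continuous_re.tendsto _).comp h
  rw [← RCLike.re_eq_complex_re, inner_self_eq_norm_sq (𝕜 := ℂ)] at h'
  refine h'.congr fun n => ?_
  simp [partialInner_self]

theorem exists_clm_weightedShift {hw : IsShiftWeight w} {K : Type*} [NormedAddCommGroup K]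
    [InnerProductSpace ℂ K] [CompleteSpace K] {ι : weightedSpace hw e E →ₗ[ℂ] K}
    (hι : DenseRange ι)
    (htend : ∀ x y : weightedSpace hw e E,
      Tendsto (fun n => partialInner w n (x : (Fin e → ℕ) → E) y) (hyperfilter ℕ : Filter ℕ)
        (nhds ⟪ι x, ι y⟫_ℂ)) (k : Fin e) :
    ∃ V : K →L[ℂ] K, (∀ x, V (ι x) = ι (weightedForwardShift hw k x)) ∧
      ∀ x, adjoint V (ι x) = ι (weightedBackwardShift hw k x) := by
  refine exists_clm_of_formal_adjoint hι (fun x y => ?_) fun x => ?_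
  · refine tendsto_nhds_unique ?_ (htend _ _)
    have h0 := (tendsto_weight_mul_levelInner hw (weightedForwardShift hw k x) y).mono_left
      Nat.hyperfilter_le_atTop
    have h := (htend (weightedForwardShift hw k x) y).add h0
    rw [add_zero] at h
    refine h.congr fun n => ?_
    rw [coe_weightedForwardShift, coe_weightedBackwardShift, partialInner_backwardShift]
  · have h := tendsto_partialNormSq_of_tendsto_partialInner (htend x x)
    have h' := tendsto_partialNormSq_of_tendsto_partialInner
      (htend (weightedBackwardShift hw k x) (weightedBackwardShift hw k x))
    have h0 := h.add (x.2.2.mono_left Nat.hyperfilter_le_atTop)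
    rw [add_zero] at h0
    have hle : ‖ι (weightedBackwardShift hw k x)‖ ^ 2 ≤ ‖ι x‖ ^ 2 :=
      le_of_tendsto_of_tendsto' h' h0 fun n =>
        partialNormSq_backwardShift_le hw n k (x : (Fin e → ℕ) → E)
    exact (sq_le_sq₀ (norm_nonneg _) (norm_nonneg _)).mp hle

theorem exists_isShiftModel (hw : IsShiftWeight w) (e : ℕ) (E : Type u) [NormedAddCommGroup E]
    [InnerProductSpace ℂ E] :
    ∃ (K : Type u) (_ : NormedAddCommGroup K) (_ : InnerProductSpace ℂ K) (_ : CompleteSpace K)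
      (ι : weightedSpace hw e E →ₗ[ℂ] K) (V : Fin e → K →L[ℂ] K), IsShiftModel hw ι V := by
  have hex : ∀ x y : weightedSpace hw e E, ∃ c : ℂ,
      Tendsto (fun n => partialInner w n (x : (Fin e → ℕ) → E) y) (hyperfilter ℕ : Filter ℕ)
        (nhds c) := by
    rintro ⟨x, ⟨C, hC⟩, _⟩ ⟨y, ⟨D, hD⟩, _⟩
    exact exists_tendsto_hyperfilter fun n =>
      (norm_partialInner_le hw n x y).trans (add_le_add (hC n) (hD n))
  choose form hform using hex
  let c : PreInnerProductSpace.Core ℂ (weightedSpace hw e E) :=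
    { inner := form
      conj_inner_symm := fun x y => by
        refine tendsto_nhds_unique ?_ (hform x y)
        refine ((Complex.continuous_conj.tendsto _).comp (hform y x)).congr fun n => ?_
        simp [partialInner, conj_levelInner]
      re_inner_nonneg := fun x => by
        refine ge_of_tendsto' ((Complex.continuous_re.tendsto _).comp (hform x x)) fun n => ?_
        simp only [Function.comp_apply, partialInner_self, Complex.ofReal_re]
        exact mul_nonneg (hw.nonneg n) (Finset.sum_nonneg fun N _ => levelNormSq_nonneg N _)
      add_left := fun x y z => by
        refine tendsto_nhds_unique (hform (x + y) z) ?_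
        refine ((hform x z).add (hform y z)).congr fun n => ?_
        simp [partialInner, levelInner_add_left, Finset.sum_add_distrib, mul_add]
      smul_left := fun x y r => by
        refine tendsto_nhds_unique (hform (r • x) y) ?_
        refine ((hform x y).const_mul _).congr fun n => ?_
        simp_rw [partialInner, Submodule.coe_smul, levelInner_smul_left, ← Finset.mul_sum]
        exact mul_left_comm _ _ _ }
  obtain ⟨K, _, _, _, ι, hι, hinner⟩ := exists_hilbert_completion c
  have htend : ∀ x y : weightedSpace hw e E,
      Tendsto (fun n => partialInner w n (x : (Fin e → ℕ) → E) y) (hyperfilter ℕ : Filter ℕ)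
        (nhds ⟪ι x, ι y⟫_ℂ) := fun x y => (hinner x y).symm ▸ hform x y
  choose V hV hV' using exists_clm_weightedShift hι htend
  exact ⟨K, _, _, _, ι, V, hι, htend, hV, hV'⟩

end ShiftModel

section Tuples

variable {F : Type*} [NormedAddCommGroup F] [InnerProductSpace ℂ F] {e : ℕ}

theorem mpow_commute {T : Fin e → F →L[ℂ] F} {S : F →L[ℂ] F} (h : ∀ i, Commute S (T i))
    (α : Fin e → ℕ) : Commute S (mpow T α) := by
  refine Commute.list_prod_right _ _ fun A hA => ?_
  rw [List.mem_ofFn] at hA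
  obtain ⟨i, rfl⟩ := hA
  exact (h i).pow_right _

theorem mpow_add_single {e : ℕ} {T : Fin e → F →L[ℂ] F} (hT : Commuting T) (α : Fin e → ℕ)
    (k : Fin e) : mpow T (α + Pi.single k 1) = T k * mpow T α := by
  induction e with
  | zero => exact k.elim0
  | succ e ih =>
    have hcons : ∀ β : Fin (e + 1) → ℕ, mpow T β =
        T 0 ^ β 0 * mpow (fun i => T (Fin.succ i)) (fun i => β i.succ) := fun β => by
      simp [mpow, List.ofFn_succ]
    rw [hcons, hcons]
    refine Fin.cases ?_ (fun j => ?_) k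
    · have h0 : (fun i : Fin e => (α + Pi.single 0 1 : Fin (e + 1) → ℕ) i.succ) =
          fun i => α i.succ := by
        ext i
        simp
      rw [h0, Pi.add_apply, Pi.single_eq_same, pow_succ', mul_assoc]
    · have hj : (fun i : Fin e => (α + Pi.single j.succ 1 : Fin (e + 1) → ℕ) i.succ) =
          (fun i => α i.succ) + Pi.single j 1 := by
        ext i
        simp [Pi.single_apply]
      rw [hj, ih (T := fun i => T i.succ) (fun i j => hT i.succ j.succ), Pi.add_apply,
        Pi.single_eq_of_ne (Fin.succ_ne_zero j).symm, add_zero, ← mul_assoc, ← mul_assoc,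
        ((hT 0 j.succ).pow_left _).eq]

variable [CompleteSpace F]
variable {G : Type*} [NormedAddCommGroup G] [InnerProductSpace ℂ G] [CompleteSpace G]

/-- The family `α ↦ T^{*α} ξ`. -/
def adjointOrbit (T : Fin e → F →L[ℂ] F) : F →ₗ[ℂ] ((Fin e → ℕ) → F) :=
  LinearMap.pi fun α => (adjoint (mpow T α)).toLinearMap

theorem adjointOrbit_apply (T : Fin e → F →L[ℂ] F) (ξ : F) (α : Fin e → ℕ) :
    adjointOrbit T ξ α = adjoint (mpow T α) ξ := rfl

theorem defectSum_eq_levelNormSq (T : Fin e → F →L[ℂ] F) (N : ℕ) (ξ : F) :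
    defectSum T N ξ = levelNormSq N (adjointOrbit T ξ) := rfl

theorem backwardShift_adjointOrbit {T : Fin e → F →L[ℂ] F} (hT : Commuting T) (k : Fin e)
    (ξ : F) : backwardShift k (adjointOrbit T ξ) = adjointOrbit T (adjoint (T k) ξ) := by
  ext α
  rw [backwardShift_apply, adjointOrbit_apply, adjointOrbit_apply, mpow_add_single hT,
    ContinuousLinearMap.mul_def, adjoint_comp, comp_apply]

theorem defectSum_zero (T : Fin e → F →L[ℂ] F) (ξ : F) : defectSum T 0 ξ = ‖ξ‖ ^ 2 := by
  simp [defectSum, mpow, Finset.Nat.antidiagonalTuple_zero_right, Nat.multinomial,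
    ← star_eq_adjoint]

theorem defectSum_succ {T : Fin e → F →L[ℂ] F} (hT : Commuting T) (N : ℕ) (ξ : F) :
    defectSum T (N + 1) ξ = ∑ k, defectSum T N (adjoint (T k) ξ) := by
  simp_rw [defectSum_eq_levelNormSq, ← backwardShift_adjointOrbit hT,
    sum_levelNormSq_backwardShift]

theorem defectSum_nonneg (T : Fin e → F →L[ℂ] F) (N : ℕ) (ξ : F) : 0 ≤ defectSum T N ξ :=
  levelNormSq_nonneg N _

theorem defectSum_eq_of_intertwining {A : Fin e → F →L[ℂ] F} {B : Fin e → G →L[ℂ] G}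
    (hA : Commuting A) (hB : Commuting B) (W : F →ₗᵢ[ℂ] G)
    (hW : ∀ k x, W (adjoint (A k) x) = adjoint (B k) (W x)) (N : ℕ) (x : F) :
    defectSum A N x = defectSum B N (W x) := by
  induction N generalizing x with
  | zero => rw [defectSum_zero, defectSum_zero, W.norm_map]
  | succ N ih =>
    rw [defectSum_succ hA, defectSum_succ hB]
    exact Finset.sum_congr rfl fun k _ => by rw [ih, hW]

theorem inner_defect_eq (T : Fin e → F →L[ℂ] F) (ξ : F) :
    ⟪(1 - ∑ k, T k ∘L adjoint (T k)) ξ, ξ⟫_ℂ =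
      ((‖ξ‖ ^ 2 - ∑ k, ‖adjoint (T k) ξ‖ ^ 2 : ℝ) : ℂ) := by
  have h : ∀ k, ⟪T k (adjoint (T k) ξ), ξ⟫_ℂ = (‖adjoint (T k) ξ‖ ^ 2 : ℂ) := fun k => by
    rw [← adjoint_inner_right, inner_self_eq_norm_sq_to_K]
    rfl
  simp [h, inner_self_eq_norm_sq_to_K]

theorem isPositive_defect_iff (T : Fin e → F →L[ℂ] F) :
    (1 - ∑ k, T k ∘L adjoint (T k)).IsPositive ↔ ∀ ξ, ∑ k, ‖adjoint (T k) ξ‖ ^ 2 ≤ ‖ξ‖ ^ 2 := by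
  rw [isPositive_iff_complex]
  simp only [inner_defect_eq, RCLike.re_eq_complex_re, Complex.ofReal_re, true_and, sub_nonneg]

theorem IsRowContraction.sum_norm_adjoint_le {T : Fin e → F →L[ℂ] F} (hT : IsRowContraction T)
    (ξ : F) : ∑ k, ‖adjoint (T k) ξ‖ ^ 2 ≤ ‖ξ‖ ^ 2 :=
  (isPositive_defect_iff T).mp hT.2 ξ

theorem IsRowContraction.exists_defectOperator {T : Fin e → F →L[ℂ] F}
    (hT : IsRowContraction T) :
    ∃ D : F →L[ℂ] F, ∀ ξ, ‖D ξ‖ ^ 2 = ‖ξ‖ ^ 2 - ∑ k, ‖adjoint (T k) ξ‖ ^ 2 := by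
  obtain ⟨D, hD⟩ := CStarAlgebra.nonneg_iff_eq_star_mul_self.mp
    ((nonneg_iff_isPositive _).mpr hT.2)
  refine ⟨D, fun ξ => ?_⟩
  have h := inner_defect_eq T ξ
  rw [hD, mul_apply_eq_comp, star_eq_adjoint, adjoint_inner_left,
    inner_self_eq_norm_sq_to_K] at h
  rw [← Complex.ofReal_inj, ← h]
  simp

theorem IsRowContraction.defectSum_succ_le {T : Fin e → F →L[ℂ] F} (hT : IsRowContraction T)
    (N : ℕ) (ξ : F) : defectSum T (N + 1) ξ ≤ defectSum T N ξ := by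
  induction N generalizing ξ with
  | zero =>
    rw [defectSum_succ hT.1]
    simpa only [defectSum_zero] using hT.sum_norm_adjoint_le ξ
  | succ N ih =>
    rw [defectSum_succ hT.1, defectSum_succ hT.1 N]
    exact Finset.sum_le_sum fun k _ => ih _

theorem IsRowContraction.defectSum_le {T : Fin e → F →L[ℂ] F} (hT : IsRowContraction T)
    (N : ℕ) (ξ : F) : defectSum T N ξ ≤ ‖ξ‖ ^ 2 :=
  defectSum_zero T ξ ▸ antitone_nat_of_succ_le (f := fun N => defectSum T N ξ)
    (fun N => hT.defectSum_succ_le N ξ) N.zero_le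

theorem IsRowContraction.exists_tendsto_defectSum {T : Fin e → F →L[ℂ] F}
    (hT : IsRowContraction T) (ξ : F) :
    ∃ a, Tendsto (fun N => defectSum T N ξ) atTop (nhds a) :=
  ⟨_, tendsto_atTop_ciInf (antitone_nat_of_succ_le fun N => hT.defectSum_succ_le N ξ)
    ⟨0, by rintro _ ⟨N, rfl⟩; exact defectSum_nonneg T N ξ⟩⟩

theorem IsRowContraction.isPure_of_dense {T : Fin e → F →L[ℂ] F} (hT : IsRowContraction T)
    {s : Set F} (hs : Dense s)
    (h : ∀ ξ ∈ s, Tendsto (fun N => defectSum T N ξ) atTop (nhds 0)) : IsPure T := by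
  intro ξ
  rw [Metric.tendsto_atTop]
  intro ε hε
  obtain ⟨η, hη, hd⟩ := hs.exists_dist_lt ξ (ε := √(ε / 4)) (by positivity)
  obtain ⟨M, hM⟩ := Metric.tendsto_atTop.mp (h η hη) (ε / 4) (by positivity)
  refine ⟨M, fun N hN => ?_⟩
  have h1 := hM N hN
  rw [Real.dist_eq, sub_zero, abs_of_nonneg (defectSum_nonneg _ _ _)] at h1 ⊢
  have h2 : ‖ξ - η‖ ^ 2 < ε / 4 := by
    rw [dist_eq_norm] at hd
    exact (Real.lt_sqrt (norm_nonneg _)).mp hd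
  have h3 := levelNormSq_add_le N (adjointOrbit T (ξ - η)) (adjointOrbit T η)
  rw [← map_add, sub_add_cancel, ← defectSum_eq_levelNormSq, ← defectSum_eq_levelNormSq,
    ← defectSum_eq_levelNormSq] at h3
  linarith [hT.defectSum_le N (ξ - η)]

theorem commuting_of_adjoint {T : Fin e → F →L[ℂ] F}
    (h : ∀ i j x, adjoint (T i) (adjoint (T j) x) = adjoint (T j) (adjoint (T i) x)) :
    Commuting T := by
  intro i j
  have h' : adjoint (T i) * adjoint (T j) = adjoint (T j) * adjoint (T i) := by
    ext x
    exact h i j x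
  have := congrArg star h'
  simp only [← star_eq_adjoint, star_mul, star_star] at this
  exact this.symm

theorem adjoint_restrictCLM {f : F →L[ℂ] F} {N : Submodule ℂ F} [CompleteSpace N]
    (h : ∀ x ∈ N, f x ∈ N) (h' : ∀ x ∈ N, adjoint f x ∈ N) :
    adjoint (restrictCLM f N h) = restrictCLM (adjoint f) N h' := by
  symm
  rw [eq_adjoint_iff]
  intro x y
  exact adjoint_inner_left f (y : F) (x : F)

end Tuples

section ShiftModelProperties

variable {E : Type*} [NormedAddCommGroup E] [InnerProductSpace ℂ E] {e : ℕ} {w : ℕ → ℝ}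
variable {hw : IsShiftWeight w} {K : Type*} [NormedAddCommGroup K] [InnerProductSpace ℂ K]
  [CompleteSpace K] {ι : weightedSpace hw e E →ₗ[ℂ] K} {V : Fin e → K →L[ℂ] K}

theorem isShiftWeight_one : IsShiftWeight fun _ => 1 :=
  ⟨fun _ => zero_le_one, fun _ => le_rfl, fun _ => by norm_num⟩

theorem isShiftWeight_inv : IsShiftWeight fun n => ((n : ℝ) + 1)⁻¹ := by
  refine ⟨fun n => by positivity, fun n => ?_, fun n => ?_⟩
  · push_cast
    gcongr
    linarith
  · push_cast
    rw [← div_eq_mul_inv, inv_eq_one_div, div_le_div_iff₀ (by positivity) (by positivity)]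
    linarith [Nat.cast_nonneg (α := ℝ) n]

theorem tendsto_inv_mul_sum {a : ℕ → ℝ} {b : ℝ} (h : Tendsto a atTop (nhds b)) :
    Tendsto (fun n : ℕ => ((n : ℝ) + 1)⁻¹ * ∑ N ∈ Finset.range n, a N) atTop (nhds b) := by
  have h1 : Tendsto (fun n : ℕ => (n : ℝ) / ((n : ℝ) + 1)) atTop (nhds 1) :=
    tendsto_natCast_div_add_atTop 1
  have h2 := h1.mul h.cesaro
  rw [one_mul] at h2
  refine h2.congr fun n => ?_
  rcases Nat.eq_zero_or_pos n with rfl | hn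
  · simp
  · have : (n : ℝ) ≠ 0 := by exact_mod_cast hn.ne'
    field_simp

theorem IsShiftModel.tendsto_normSq (hM : IsShiftModel hw ι V) (x : weightedSpace hw e E) :
    Tendsto (fun n => partialNormSq w n (x : (Fin e → ℕ) → E)) (hyperfilter ℕ : Filter ℕ)
      (nhds (‖ι x‖ ^ 2)) :=
  tendsto_partialNormSq_of_tendsto_partialInner (hM.tendsto_inner x x)

theorem IsShiftModel.normSq_eq (hM : IsShiftModel hw ι V) (x : weightedSpace hw e E) {a : ℝ}
    (h : Tendsto (fun n => partialNormSq w n (x : (Fin e → ℕ) → E)) atTop (nhds a)) :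
    ‖ι x‖ ^ 2 = a :=
  tendsto_nhds_unique (hM.tendsto_normSq x) (h.mono_left Nat.hyperfilter_le_atTop)

theorem IsShiftModel.commuting (hM : IsShiftModel hw ι V) : Commuting V := by
  refine commuting_of_adjoint fun i j => congrFun ?_
  refine hM.denseRange.equalizer (by fun_prop) (by fun_prop) (funext fun x => ?_)
  simp only [Function.comp_apply, hM.adjoint_apply_eq]
  congr 1
  ext α
  simp only [coe_weightedBackwardShift, backwardShift_apply, add_right_comm]

theorem IsShiftModel.tendsto_partialNormSq_one
    {ι : weightedSpace isShiftWeight_one e E →ₗ[ℂ] K} (hM : IsShiftModel isShiftWeight_one ι V)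
    (x : weightedSpace isShiftWeight_one e E) :
    Tendsto (fun n => ∑ N ∈ Finset.range n, levelNormSq N (x : (Fin e → ℕ) → E)) atTop
      (nhds (‖ι x‖ ^ 2)) := by
  obtain ⟨C, hC⟩ := x.2.1
  have hmono : Monotone fun n => ∑ N ∈ Finset.range n, levelNormSq N (x : (Fin e → ℕ) → E) :=
    monotone_nat_of_le_succ fun n => by
      rw [Finset.sum_range_succ]
      exact le_add_of_nonneg_right (levelNormSq_nonneg _ _)
  have h := tendsto_atTop_ciSup hmono ⟨C, by
    rintro _ ⟨n, rfl⟩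
    simpa [partialNormSq] using hC n⟩
  rwa [hM.normSq_eq x (h.congr fun n => by simp [partialNormSq])]

theorem IsShiftModel.sum_norm_adjoint {ι : weightedSpace isShiftWeight_one e E →ₗ[ℂ] K}
    (hM : IsShiftModel isShiftWeight_one ι V) (x : weightedSpace isShiftWeight_one e E) :
    ∑ k, ‖adjoint (V k) (ι x)‖ ^ 2 = ‖ι x‖ ^ 2 - levelNormSq 0 (x : (Fin e → ℕ) → E) := by
  refine tendsto_nhds_unique ?_ (((tendsto_add_atTop_iff_nat 1).mpr
    (hM.tendsto_partialNormSq_one x)).sub_const _)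
  simp_rw [hM.adjoint_apply_eq]
  refine (tendsto_finsetSum Finset.univ fun k _ =>
    hM.tendsto_partialNormSq_one (weightedBackwardShift _ k x)).congr fun n => ?_
  rw [Finset.sum_comm, Finset.sum_range_succ', add_sub_cancel_right]
  exact Finset.sum_congr rfl fun N _ => sum_levelNormSq_backwardShift N _

theorem IsShiftModel.isRowContraction {ι : weightedSpace isShiftWeight_one e E →ₗ[ℂ] K}
    (hM : IsShiftModel isShiftWeight_one ι V) : IsRowContraction V := by
  refine ⟨hM.commuting, (isPositive_defect_iff V).mpr fun ξ => ?_⟩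
  refine hM.denseRange.induction_on ξ (isClosed_le (by fun_prop) (by fun_prop)) fun x => ?_
  rw [hM.sum_norm_adjoint]
  exact sub_le_self _ (levelNormSq_nonneg _ _)

theorem IsShiftModel.defectSum_eq {ι : weightedSpace isShiftWeight_one e E →ₗ[ℂ] K}
    (hM : IsShiftModel isShiftWeight_one ι V) (n : ℕ) (x : weightedSpace isShiftWeight_one e E) :
    defectSum V n (ι x) =
      ‖ι x‖ ^ 2 - ∑ N ∈ Finset.range n, levelNormSq N (x : (Fin e → ℕ) → E) := by
  induction n generalizing x with
  | zero => simp [defectSum_zero]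
  | succ n ih =>
    rw [defectSum_succ hM.commuting]
    simp_rw [hM.adjoint_apply_eq, ih]
    rw [Finset.sum_sub_distrib, Finset.sum_comm]
    simp_rw [← hM.adjoint_apply_eq, coe_weightedBackwardShift, sum_levelNormSq_backwardShift]
    rw [hM.sum_norm_adjoint, Finset.sum_range_succ']
    ring

theorem IsShiftModel.isPure {ι : weightedSpace isShiftWeight_one e E →ₗ[ℂ] K}
    (hM : IsShiftModel isShiftWeight_one ι V) : IsPure V := by
  refine hM.isRowContraction.isPure_of_dense hM.denseRange ?_
  rintro _ ⟨x, rfl⟩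
  simp_rw [hM.defectSum_eq]
  have h := (hM.tendsto_partialNormSq_one x).const_sub (‖ι x‖ ^ 2)
  rwa [sub_self] at h

theorem IsShiftModel.eq_zero {ι : weightedSpace isShiftWeight_inv e E →ₗ[ℂ] K}
    (hM : IsShiftModel isShiftWeight_inv ι V) {x : weightedSpace isShiftWeight_inv e E}
    (h : Tendsto (fun N => levelNormSq N (x : (Fin e → ℕ) → E)) atTop (nhds 0)) : ι x = 0 := by
  have h' := hM.normSq_eq x (tendsto_inv_mul_sum h)
  simpa using h'

theorem IsShiftModel.isSphericalUnitary {ι : weightedSpace isShiftWeight_inv e E →ₗ[ℂ] K}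
    (hM : IsShiftModel isShiftWeight_inv ι V) : IsSphericalUnitary V := by
  refine ⟨hM.commuting, fun k => ContinuousLinearMap.ext (congrFun ?_),
    ContinuousLinearMap.ext (congrFun ?_)⟩
  · refine hM.denseRange.equalizer (by fun_prop) (by fun_prop) (funext fun x => ?_)
    simp only [Function.comp_apply, comp_apply, hM.adjoint_apply_eq, hM.apply_eq]
    rw [← sub_eq_zero, ← map_sub]
    refine hM.eq_zero (squeeze_zero (fun N => levelNormSq_nonneg N _) (fun N => ?_) x.2.2)
    have h := levelNormSq_selfCommutator_le N k (x : (Fin e → ℕ) → E)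
    rw [one_div] at h
    exact h
  · refine hM.denseRange.equalizer (by fun_prop) (by fun_prop) (funext fun x => ?_)
    simp only [Function.comp_apply, sum_apply, comp_apply, hM.adjoint_apply_eq, hM.apply_eq,
      one_apply_eq_self]
    rw [← sub_eq_zero, ← map_sum, ← map_sub]
    refine hM.eq_zero (tendsto_const_nhds.congr' ?_)
    filter_upwards [eventually_ge_atTop 1] with N hN
    symm
    refine Finset.sum_eq_zero fun α hα => ?_
    rw [Finset.Nat.mem_antidiagonalTuple] at hα
    have h := sum_forwardShift_backwardShift (x : (Fin e → ℕ) → E) (β := α) (by omega)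
    simp [coe_weightedBackwardShift, coe_weightedForwardShift, h]

end ShiftModelProperties

section Embedding

variable {F : Type*} [NormedAddCommGroup F] [InnerProductSpace ℂ F] [CompleteSpace F] {e : ℕ}
variable {T : Fin e → F →L[ℂ] F} {D : F →L[ℂ] F}

/-- The family `α ↦ D T^{*α} ξ`. -/
def defectOrbit (T : Fin e → F →L[ℂ] F) (D : F →L[ℂ] F) : F →ₗ[ℂ] ((Fin e → ℕ) → F) :=
  LinearMap.pi fun α => (D ∘L adjoint (mpow T α)).toLinearMap

theorem defectOrbit_apply (ξ : F) (α : Fin e → ℕ) :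
    defectOrbit T D ξ α = D (adjoint (mpow T α) ξ) := rfl

theorem backwardShift_defectOrbit (hT : Commuting T) (k : Fin e) (ξ : F) :
    backwardShift k (defectOrbit T D ξ) = defectOrbit T D (adjoint (T k) ξ) := by
  ext α
  exact congrArg D (congrFun (backwardShift_adjointOrbit hT k ξ) α)

theorem adjoint_mpow_adjoint_apply (hT : Commuting T) (k : Fin e) (α : Fin e → ℕ) (ξ : F) :
    adjoint (mpow T α) (adjoint (T k) ξ) = adjoint (T k) (adjoint (mpow T α) ξ) := by
  rw [← comp_apply, ← comp_apply, ← adjoint_comp, ← adjoint_comp]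
  exact congrArg (fun A => adjoint A ξ) (mpow_commute (hT k) α).eq

theorem levelNormSq_defectOrbit (hT : Commuting T)
    (hD : ∀ ξ, ‖D ξ‖ ^ 2 = ‖ξ‖ ^ 2 - ∑ k, ‖adjoint (T k) ξ‖ ^ 2) (N : ℕ) (ξ : F) :
    levelNormSq N (defectOrbit T D ξ) = defectSum T N ξ - defectSum T (N + 1) ξ := by
  rw [defectSum_succ hT]
  simp_rw [defectSum, adjoint_mpow_adjoint_apply hT]
  rw [Finset.sum_comm, ← Finset.sum_sub_distrib]
  refine Finset.sum_congr rfl fun α _ => ?_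
  rw [defectOrbit_apply, hD, mul_sub, Finset.mul_sum]

theorem sum_range_levelNormSq_defectOrbit (hT : Commuting T)
    (hD : ∀ ξ, ‖D ξ‖ ^ 2 = ‖ξ‖ ^ 2 - ∑ k, ‖adjoint (T k) ξ‖ ^ 2) (n : ℕ) (ξ : F) :
    ∑ N ∈ Finset.range n, levelNormSq N (defectOrbit T D ξ) = ‖ξ‖ ^ 2 - defectSum T n ξ := by
  simp_rw [levelNormSq_defectOrbit hT hD]
  rw [Finset.sum_range_sub', defectSum_zero]

theorem defectOrbit_mem (hT : IsRowContraction T)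
    (hD : ∀ ξ, ‖D ξ‖ ^ 2 = ‖ξ‖ ^ 2 - ∑ k, ‖adjoint (T k) ξ‖ ^ 2) (ξ : F) :
    defectOrbit T D ξ ∈ weightedSpace isShiftWeight_one e F := by
  refine ⟨⟨‖ξ‖ ^ 2, fun n => ?_⟩, ?_⟩
  · rw [partialNormSq, one_mul, sum_range_levelNormSq_defectOrbit hT.1 hD]
    exact sub_le_self _ (defectSum_nonneg T n ξ)
  · obtain ⟨a, ha⟩ := hT.exists_tendsto_defectSum ξ
    have h := ha.sub ((tendsto_add_atTop_iff_nat 1).mpr ha)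
    rw [sub_self] at h
    exact h.congr fun n => by rw [one_mul, levelNormSq_defectOrbit hT.1 hD]

theorem adjointOrbit_mem (hT : IsRowContraction T) (ξ : F) :
    adjointOrbit T ξ ∈ weightedSpace isShiftWeight_inv e F := by
  obtain ⟨a, ha⟩ := hT.exists_tendsto_defectSum ξ
  refine ⟨?_, ?_⟩
  · obtain ⟨C, hC⟩ := (tendsto_inv_mul_sum ha).bddAbove_range
    exact ⟨C, fun n => hC ⟨n, rfl⟩⟩
  · have h := (tendsto_one_div_add_atTop_nhds_zero_nat (𝕜 := ℝ)).mul ha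
    rw [zero_mul] at h
    exact h.congr fun n => by rw [one_div]; rfl

end Embedding

section DirectSum

variable {K₁ : Type*} [NormedAddCommGroup K₁] [InnerProductSpace ℂ K₁]
variable {K₂ : Type*} [NormedAddCommGroup K₂] [InnerProductSpace ℂ K₂] {e : ℕ}

/-- The orthogonal direct sum of two operators. -/
def directSum (A : K₁ →L[ℂ] K₁) (B : K₂ →L[ℂ] K₂) :
    WithLp 2 (K₁ × K₂) →L[ℂ] WithLp 2 (K₁ × K₂) :=
  (WithLp.prodContinuousLinearEquiv 2 ℂ K₁ K₂).symm ∘L A.prodMap B ∘L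
    (WithLp.prodContinuousLinearEquiv 2 ℂ K₁ K₂)

theorem directSum_apply (A : K₁ →L[ℂ] K₁) (B : K₂ →L[ℂ] K₂) (x : WithLp 2 (K₁ × K₂)) :
    directSum A B x = WithLp.toLp 2 (A x.fst, B x.snd) := rfl

theorem commuting_directSum {A : Fin e → K₁ →L[ℂ] K₁} {B : Fin e → K₂ →L[ℂ] K₂}
    (hA : Commuting A) (hB : Commuting B) : Commuting fun k => directSum (A k) (B k) := by
  intro i j
  ext x
  exact congrArg (WithLp.toLp 2) (Prod.ext (congrArg (fun S => S x.fst) (hA i j).eq)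
    (congrArg (fun S => S x.snd) (hB i j).eq))

/-- The first summand of the orthogonal direct sum. -/
def firstSummand (K₁ K₂ : Type*) [NormedAddCommGroup K₁] [InnerProductSpace ℂ K₁]
    [NormedAddCommGroup K₂] [InnerProductSpace ℂ K₂] : Submodule ℂ (WithLp 2 (K₁ × K₂)) :=
  (WithLp.sndL 2 ℂ K₁ K₂).ker

/-- The second summand of the orthogonal direct sum. -/
def secondSummand (K₁ K₂ : Type*) [NormedAddCommGroup K₁] [InnerProductSpace ℂ K₁]
    [NormedAddCommGroup K₂] [InnerProductSpace ℂ K₂] : Submodule ℂ (WithLp 2 (K₁ × K₂)) :=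
  (WithLp.fstL 2 ℂ K₁ K₂).ker

theorem mem_firstSummand {x : WithLp 2 (K₁ × K₂)} : x ∈ firstSummand K₁ K₂ ↔ x.snd = 0 := Iff.rfl

theorem firstSummand_sup_secondSummand : firstSummand K₁ K₂ ⊔ secondSummand K₁ K₂ = ⊤ := by
  refine Submodule.eq_top_iff'.mpr fun x => Submodule.mem_sup.mpr
    ⟨WithLp.toLp 2 (x.fst, 0), rfl, WithLp.toLp 2 (0, x.snd), rfl, ?_⟩
  rw [← WithLp.toLp_add, Prod.mk_add_mk, add_zero, zero_add]
  rfl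

theorem inner_eq_zero_of_mem_summands {x y : WithLp 2 (K₁ × K₂)} (hx : x ∈ firstSummand K₁ K₂)
    (hy : y ∈ secondSummand K₁ K₂) : ⟪x, y⟫_ℂ = 0 := by
  rw [WithLp.prod_inner_apply]
  have hx' : (WithLp.ofLp x).2 = 0 := hx
  have hy' : (WithLp.ofLp y).1 = 0 := hy
  rw [hx', hy', inner_zero_left, inner_zero_right, add_zero]

variable [CompleteSpace K₁] [CompleteSpace K₂]

theorem adjoint_directSum (A : K₁ →L[ℂ] K₁) (B : K₂ →L[ℂ] K₂) :
    adjoint (directSum A B) = directSum (adjoint A) (adjoint B) := by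
  symm
  rw [eq_adjoint_iff]
  intro x y
  simp [WithLp.prod_inner_apply, directSum_apply, adjoint_inner_left]

theorem adjoint_directSum_apply (A : K₁ →L[ℂ] K₁) (B : K₂ →L[ℂ] K₂) (x : WithLp 2 (K₁ × K₂)) :
    adjoint (directSum A B) x = WithLp.toLp 2 (adjoint A x.fst, adjoint B x.snd) := by
  rw [adjoint_directSum, directSum_apply]

theorem IsSphericalUnitary.sum_norm_adjoint {U : Fin e → K₂ →L[ℂ] K₂}
    (hU : IsSphericalUnitary U) (ξ : K₂) : ∑ k, ‖adjoint (U k) ξ‖ ^ 2 = ‖ξ‖ ^ 2 := by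
  have h := inner_defect_eq U ξ
  rw [hU.2.2, sub_self, zero_apply, inner_zero_left, eq_comm, Complex.ofReal_eq_zero,
    sub_eq_zero] at h
  exact h.symm

theorem isRowContraction_directSum {A : Fin e → K₁ →L[ℂ] K₁} {B : Fin e → K₂ →L[ℂ] K₂}
    (hA : IsRowContraction A) (hB : IsSphericalUnitary B) :
    IsRowContraction fun k => directSum (A k) (B k) := by
  refine ⟨commuting_directSum hA.1 hB.1, (isPositive_defect_iff _).mpr fun ξ => ?_⟩
  simp only [adjoint_directSum_apply, WithLp.prod_norm_sq_eq_of_L2, Finset.sum_add_distrib]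
  exact add_le_add (hA.sum_norm_adjoint_le _) (hB.sum_norm_adjoint _).le

theorem reduces_firstSummand (A : Fin e → K₁ →L[ℂ] K₁) (B : Fin e → K₂ →L[ℂ] K₂) :
    Reduces (fun k => directSum (A k) (B k)) (firstSummand K₁ K₂) := by
  refine ⟨fun k x hx => ?_, fun k x hx => ?_⟩
  · exact (congrArg (B k) hx).trans (map_zero _)
  · rw [adjoint_directSum_apply]
    exact (congrArg (adjoint (B k)) hx).trans (map_zero _)

theorem reduces_secondSummand (A : Fin e → K₁ →L[ℂ] K₁) (B : Fin e → K₂ →L[ℂ] K₂) :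
    Reduces (fun k => directSum (A k) (B k)) (secondSummand K₁ K₂) := by
  refine ⟨fun k x hx => ?_, fun k x hx => ?_⟩
  · exact (congrArg (A k) hx).trans (map_zero _)
  · rw [adjoint_directSum_apply]
    exact (congrArg (adjoint (A k)) hx).trans (map_zero _)

theorem isPure_restrict_firstSummand [CompleteSpace (firstSummand K₁ K₂)]
    {A : Fin e → K₁ →L[ℂ] K₁} {B : Fin e → K₂ →L[ℂ] K₂}
    (hA : Commuting A) (hB : Commuting B) (hp : IsPure A) :
    IsPure (restrictTuple (fun k => directSum (A k) (B k)) (firstSummand K₁ K₂)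
      (reduces_firstSummand A B).1) := by
  let W : firstSummand K₁ K₂ →ₗᵢ[ℂ] K₁ :=
    { toLinearMap := (WithLp.fstL 2 ℂ K₁ K₂).toLinearMap ∘ₗ (firstSummand K₁ K₂).subtype
      norm_map' := fun x => by
        have h := WithLp.prod_norm_sq_eq_of_L2 (x : WithLp 2 (K₁ × K₂))
        rw [mem_firstSummand.mp x.2, norm_zero, zero_pow two_ne_zero, add_zero] at h
        exact ((sq_eq_sq₀ (norm_nonneg _) (norm_nonneg _)).mp h).symm }
  intro x
  refine (hp (W x)).congr fun N => (defectSum_eq_of_intertwining (fun i j => ?_) hA W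
    (fun k y => ?_) N x).symm
  · ext1 y
    exact Subtype.ext (congrArg (fun S => S (y : WithLp 2 (K₁ × K₂)))
      (commuting_directSum hA hB i j).eq)
  · rw [restrictTuple, adjoint_restrictCLM _ ((reduces_firstSummand A B).2 k)]
    exact congrArg WithLp.fst (adjoint_directSum_apply (A k) (B k) y)

theorem isSphericalUnitary_restrict_secondSummand [CompleteSpace (secondSummand K₁ K₂)]
    {A : Fin e → K₁ →L[ℂ] K₁}
    {B : Fin e → K₂ →L[ℂ] K₂} (hB : IsSphericalUnitary B) :
    IsSphericalUnitary (restrictTuple (fun k => directSum (A k) (B k)) (secondSummand K₁ K₂)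
      (reduces_secondSummand A B).1) := by
  have hext : ∀ x y : secondSummand K₁ K₂,
      (x : WithLp 2 (K₁ × K₂)).snd = (y : WithLp 2 (K₁ × K₂)).snd → x = y := fun x y h =>
    Subtype.ext (WithLp.ofLp_injective 2 (Prod.ext (x.2.trans y.2.symm) h))
  set R := restrictTuple (fun k => directSum (A k) (B k)) (secondSummand K₁ K₂)
    (reduces_secondSummand A B).1 with hR
  have hsnd : ∀ k x, (R k x : WithLp 2 (K₁ × K₂)).snd =
      B k (x : WithLp 2 (K₁ × K₂)).snd := fun _ _ => rfl
  have hadj : ∀ k x, (adjoint (R k) x : WithLp 2 (K₁ × K₂)).snd =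
      adjoint (B k) (x : WithLp 2 (K₁ × K₂)).snd := fun k x => by
    rw [hR, restrictTuple, adjoint_restrictCLM _ ((reduces_secondSummand A B).2 k)]
    exact congrArg WithLp.snd (adjoint_directSum_apply (A k) (B k) x)
  clear_value R
  refine ⟨fun i j => ?_, fun k => ?_, ?_⟩
  · ext1 y
    refine hext _ _ ?_
    rw [mul_apply_eq_comp, mul_apply_eq_comp, hsnd, hsnd, hsnd, hsnd]
    exact congrArg (fun S => S (y : WithLp 2 (K₁ × K₂)).snd) (hB.1 i j).eq
  · ext1 y
    refine hext _ _ ?_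
    rw [comp_apply, comp_apply, hsnd, hadj, hadj, hsnd]
    exact congrArg (fun S => S (y : WithLp 2 (K₁ × K₂)).snd) (hB.2.1 k)
  · ext1 y
    refine hext _ _ ?_
    rw [sum_apply, Submodule.coe_sum]
    refine Eq.trans ?_ (congrArg (fun S => S (y : WithLp 2 (K₁ × K₂)).snd) hB.2.2)
    rw [sum_apply]
    refine (map_sum (WithLp.sndL 2 ℂ K₁ K₂) _ _).trans (Finset.sum_congr rfl fun k _ => ?_)
    exact (hsnd k _).trans (congrArg (B k) (hadj k y))

end DirectSum

theorem nonempty_pureSphericalCoextension {H K₁ K₂ : Type u} [NormedAddCommGroup H]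
    [InnerProductSpace ℂ H] [CompleteSpace H] [NormedAddCommGroup K₁] [InnerProductSpace ℂ K₁]
    [CompleteSpace K₁] [NormedAddCommGroup K₂] [InnerProductSpace ℂ K₂] [CompleteSpace K₂]
    {d : ℕ} {T : Fin d → H →L[ℂ] H} {A : Fin d → K₁ →L[ℂ] K₁} {B : Fin d → K₂ →L[ℂ] K₂}
    (hA : IsRowContraction A) (hp : IsPure A) (hB : IsSphericalUnitary B)
    (j₁ : H →ₗ[ℂ] K₁) (j₂ : H →ₗ[ℂ] K₂) (hj : ∀ ξ, ‖j₁ ξ‖ ^ 2 + ‖j₂ ξ‖ ^ 2 = ‖ξ‖ ^ 2)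
    (h₁ : ∀ k ξ, adjoint (A k) (j₁ ξ) = j₁ (adjoint (T k) ξ))
    (h₂ : ∀ k ξ, adjoint (B k) (j₂ ξ) = j₂ (adjoint (T k) ξ)) :
    Nonempty (PureSphericalCoextension T) := by
  let emb : H →ₗᵢ[ℂ] WithLp 2 (K₁ × K₂) :=
    { toLinearMap := (WithLp.linearEquiv 2 ℂ (K₁ × K₂)).symm.toLinearMap ∘ₗ j₁.prod j₂
      norm_map' := fun ξ => by
        refine (sq_eq_sq₀ (norm_nonneg _) (norm_nonneg _)).mp ?_
        rw [WithLp.prod_norm_sq_eq_of_L2]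
        exact hj ξ }
  have hcoext : ∀ k ξ, adjoint (directSum (A k) (B k)) (emb ξ) = emb (adjoint (T k) ξ) :=
    fun k ξ => (adjoint_directSum_apply _ _ _).trans
      (congrArg (WithLp.toLp 2) (Prod.ext (h₁ k ξ) (h₂ k ξ)))
  have hc₁ : IsClosed (firstSummand K₁ K₂ : Set (WithLp 2 (K₁ × K₂))) :=
    (WithLp.sndL 2 ℂ K₁ K₂).isClosed_ker
  have hc₂ : IsClosed (secondSummand K₁ K₂ : Set (WithLp 2 (K₁ × K₂))) :=
    (WithLp.fstL 2 ℂ K₁ K₂).isClosed_ker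
  let _ : CompleteSpace (firstSummand K₁ K₂) := hc₁.completeSpace_coe
  let _ : CompleteSpace (secondSummand K₁ K₂) := hc₂.completeSpace_coe
  exact ⟨{
    K := WithLp 2 (K₁ × K₂)
    emb := emb
    K₁ := firstSummand K₁ K₂
    K₂ := secondSummand K₁ K₂
    hK₁ := hc₁
    hK₂ := hc₂
    orth := fun _ hx _ hy => inner_eq_zero_of_mem_summands hx hy
    compl := firstSummand_sup_secondSummand
    V := fun k => directSum (A k) (B k)
    hV := isRowContraction_directSum hA hB
    red₁ := reduces_firstSummand A B
    red₂ := reduces_secondSummand A B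
    pure₁ := isPure_restrict_firstSummand hA.1 hB.1 hp
    su₂ := isSphericalUnitary_restrict_secondSummand hB
    coinv := fun k ξ => ⟨adjoint (T k) ξ, (hcoext k ξ).symm⟩
    coext := hcoext }⟩
/-- Every commuting row contraction has a co-extension which is the orthogonal
direct sum of a pure commuting row contraction and a spherical unitary
(Müller–Vasilescu/Arveson dilation theorem, abstract form). -/
theorem exists_pureSphericalCoextension
    {H : Type u} [NormedAddCommGroup H] [InnerProductSpace ℂ H] [CompleteSpace H]
    {d : ℕ} (T : Fin d → H →L[ℂ] H) (hT : IsRowContraction T) :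
    Nonempty (PureSphericalCoextension T) := by
  obtain ⟨D, hD⟩ := hT.exists_defectOperator
  obtain ⟨K₁, _, _, _, ι₁, A, hA⟩ := exists_isShiftModel isShiftWeight_one d H
  obtain ⟨K₂, _, _, _, ι₂, B, hB⟩ := exists_isShiftModel isShiftWeight_inv d H
  refine nonempty_pureSphericalCoextension hA.isRowContraction hA.isPure hB.isSphericalUnitary
    (ι₁ ∘ₗ (defectOrbit T D).codRestrict _ (defectOrbit_mem hT hD))
    (ι₂ ∘ₗ (adjointOrbit T).codRestrict _ (adjointOrbit_mem hT))
    (fun ξ => ?_) (fun k ξ => ?_) fun k ξ => ?_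
  · obtain ⟨a, ha⟩ := hT.exists_tendsto_defectSum ξ
    rw [LinearMap.comp_apply, LinearMap.comp_apply]
    have h₁ := hA.normSq_eq ((defectOrbit T D).codRestrict _ (defectOrbit_mem hT hD) ξ)
      ((ha.const_sub (‖ξ‖ ^ 2)).congr fun n => by
        rw [partialNormSq, one_mul, LinearMap.codRestrict_apply,
          sum_range_levelNormSq_defectOrbit hT.1 hD])
    have h₂ := hB.normSq_eq ((adjointOrbit T).codRestrict _ (adjointOrbit_mem hT) ξ)
      (tendsto_inv_mul_sum ha)
    rw [h₁, h₂, sub_add_cancel]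
  · rw [LinearMap.comp_apply, LinearMap.comp_apply, hA.adjoint_apply_eq]
    exact congrArg ι₁ (Subtype.ext (backwardShift_defectOrbit hT.1 k ξ))
  · rw [LinearMap.comp_apply, LinearMap.comp_apply, hB.adjoint_apply_eq]
    exact congrArg ι₂ (Subtype.ext (backwardShift_adjointOrbit hT.1 k ξ))

end RowCtr
end
end

section
/- Every spherical isometry extends to a spherical unitary. That is, if S = (S_1,…,S_d) is a d-tuple of pairwise commuting bounded linear operators on a complex Hilbert space H with ∑_{k=1}^d S_k* S_k = I, then there exists a complex Hilbert space K containing H isometrically and a spherical unitary U = (U_1,…,U_d) on K such that H is invariant for each U_k and U_k|_H = S_k for each 1 ≤ k ≤ d. -/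
noncomputable section

open ContinuousLinearMap Filter

namespace RowCtr

universe u

/-- An extension of the tuple `S` to a spherical unitary: a Hilbert space `K` containing `H`
isometrically and a spherical unitary `U` on `K` such that (the image of) `H` is invariant for
each `Uₖ` and `Uₖ|_H = Sₖ`. -/
structure SphericalUnitaryExtension {H : Type u} [NormedAddCommGroup H]
    [InnerProductSpace ℂ H] [CompleteSpace H] {d : ℕ} (S : Fin d → H →L[ℂ] H) where
  K : Type u
  [nacg : NormedAddCommGroup K]
  [ips : InnerProductSpace ℂ K]
  [cpl : CompleteSpace K]
  /-- The isometric inclusion of `H` in `K`. -/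
  emb : H →ₗᵢ[ℂ] K
  /-- The extending tuple. -/
  U : Fin d → K →L[ℂ] K
  hU : IsSphericalUnitary U
  /-- `H` is invariant for each `Uₖ` and `Uₖ|_H = Sₖ`. -/
  ext : ∀ (k : Fin d) (ξ : H), U k (emb ξ) = emb (S k ξ)

section Positivity

variable {H : Type*} [NormedAddCommGroup H] [InnerProductSpace ℂ H]

/-- For commuting operators with `∑ Tₐ* Tₐ = 1` and vectors `ξₐ`, the words of length `L` carry
vectors whose total squared norm is `L ∑ ‖ξₐ‖² + L (L - 1) Re ∑ ⟪Tₐ ξ_b, T_b ξₐ⟫`. -/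
theorem exists_sum_norm_sq_eq {A : Type} [Fintype A] (T : A → H →L[ℂ] H)
    (hcomm : ∀ a b, Commute (T a) (T b))
    (hT : ∀ x y, ∑ a, inner ℂ (T a x) (T a y) = inner ℂ x y) (ξ : A → H) (L : ℕ) :
    ∃ (ι : Type) (_ : Fintype ι) (R : ι → H →L[ℂ] H) (y : ι → H),
      (∀ i a, Commute (R i) (T a)) ∧
      (∀ x z, ∑ i, inner ℂ (R i x) (R i z) = inner ℂ x z) ∧
      (∑ a, ∑ i, inner ℂ (T a (y i)) (R i (ξ a)) =
        L * ∑ a, ∑ b, inner ℂ (T a (ξ b)) (T b (ξ a))) ∧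
      ∑ i, ‖y i‖ ^ 2 = L * ∑ a, ‖ξ a‖ ^ 2 +
        L * (L - 1) * (∑ a, ∑ b, inner ℂ (T a (ξ b)) (T b (ξ a))).re := by
  have hsq : ∀ {ι : Type} [Fintype ι] (R : ι → H →L[ℂ] H),
      (∀ x z, ∑ i, inner ℂ (R i x) (R i z) = inner ℂ x z) →
      ∀ x, ∑ i, ‖R i x‖ ^ 2 = ‖x‖ ^ 2 := by
    intro ι _ R hR x
    have h := hR x x
    simp only [inner_self_eq_norm_sq_to_K] at h
    exact_mod_cast h
  induction L with
  | zero =>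
    refine ⟨Unit, inferInstance, fun _ => 1, fun _ => 0, ?_, ?_, ?_, ?_⟩ <;> simp
  | succ L ih =>
    obtain ⟨ι, _, R, y, hRT, hR, hX, hN⟩ := ih
    have app (i : ι) (a : A) (x : H) : R i (T a x) = T a (R i x) :=
      DFunLike.congr_fun (hRT i a) x
    have appT (a b : A) (x : H) : T a (T b x) = T b (T a x) :=
      DFunLike.congr_fun (hcomm a b) x
    refine ⟨A × ι, inferInstance, fun p => T p.1 * R p.2,
      fun p => T p.1 (y p.2) + R p.2 (ξ p.1), ?_, ?_, ?_, ?_⟩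
    · exact fun p a => (hcomm p.1 a).mul_left (hRT p.2 a)
    · intro x z
      rw [Fintype.sum_prod_type_right]
      simp only [mul_apply_eq_comp, hT, hR]
    · have step (a : A) : ∑ p : A × ι,
          inner ℂ (T a (T p.1 (y p.2) + R p.2 (ξ p.1))) ((T p.1 * R p.2) (ξ a)) =
          ∑ i, inner ℂ (T a (y i)) (R i (ξ a)) +
            ∑ b, inner ℂ (T a (ξ b)) (T b (ξ a)) := by
        simp only [map_add, inner_add_left, Finset.sum_add_distrib, mul_apply_eq_comp]
        congr 1
        · rw [Fintype.sum_prod_type_right]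
          simp only [appT a, hT]
        · rw [Fintype.sum_prod_type]
          simp only [← app, hR]
      simp only [step, Finset.sum_add_distrib, hX]
      push_cast
      ring
    · have h1 : ∑ p : A × ι, ‖T p.1 (y p.2)‖ ^ 2 = ∑ i, ‖y i‖ ^ 2 := by
        rw [Fintype.sum_prod_type_right]
        simp only [hsq T hT]
      have h2 : ∑ p : A × ι, ‖R p.2 (ξ p.1)‖ ^ 2 = ∑ a, ‖ξ a‖ ^ 2 := by
        rw [Fintype.sum_prod_type]
        simp only [hsq R hR]
      have h3 : ∑ p : A × ι, (inner ℂ (T p.1 (y p.2)) (R p.2 (ξ p.1))).re =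
          L * (∑ a, ∑ b, inner ℂ (T a (ξ b)) (T b (ξ a))).re := by
        rw [← Complex.re_sum, Fintype.sum_prod_type, hX, ← Complex.ofReal_natCast, Complex.re_ofReal_mul]
      simp only [norm_add_sq (𝕜 := ℂ), Finset.sum_add_distrib, RCLike.re_to_complex,
        ← Finset.mul_sum]
      rw [h1, h2, h3, hN]
      push_cast
      ring

theorem re_sum_inner_nonneg_of_sum_eq {A : Type} [Fintype A] (T : A → H →L[ℂ] H)
    (hcomm : ∀ a b, Commute (T a) (T b))
    (hT : ∀ x y, ∑ a, inner ℂ (T a x) (T a y) = inner ℂ x y) (ξ : A → H) :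
    0 ≤ (∑ a, ∑ b, inner ℂ (T a (ξ b)) (T b (ξ a))).re := by
  by_contra! hneg
  obtain ⟨n, hn⟩ := exists_nat_gt
    ((∑ a, ‖ξ a‖ ^ 2) / -(∑ a, ∑ b, inner ℂ (T a (ξ b)) (T b (ξ a))).re)
  obtain ⟨ι, _, R, y, -, -, -, hN⟩ := exists_sum_norm_sq_eq T hcomm hT ξ (n + 1)
  rw [div_lt_iff₀ (by linarith)] at hn
  have h0 : 0 ≤ ∑ i, ‖y i‖ ^ 2 := by positivity
  rw [hN] at h0
  push_cast at h0
  have : (0 : ℝ) < n + 1 := by positivity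
  nlinarith

theorem re_sum_inner_nonneg {A : Type} [Fintype A] (T : A → H →L[ℂ] H)
    (hcomm : ∀ a b, Commute (T a) (T b)) {c : ℝ} (hc : 0 < c)
    (hT : ∀ x y, ∑ a, inner ℂ (T a x) (T a y) = c * inner ℂ x y) (ξ : A → H) :
    0 ≤ (∑ a, ∑ b, inner ℂ (T a (ξ b)) (T b (ξ a))).re := by
  have hs : ((√c : ℝ) : ℂ)⁻¹ * ((√c : ℝ) : ℂ)⁻¹ = (c : ℂ)⁻¹ := by
    rw [← mul_inv, ← Complex.ofReal_mul, Real.mul_self_sqrt hc.le]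
  have hc' : (c : ℂ) ≠ 0 := by exact_mod_cast hc.ne'
  have key (a b : A) (x y : H) : inner ℂ ((((√c : ℝ) : ℂ)⁻¹ • T a) x) ((((√c : ℝ) : ℂ)⁻¹ • T b) y) =
      (c : ℂ)⁻¹ * inner ℂ (T a x) (T b y) := by
    rw [smul_apply, smul_apply, inner_smul_left,
      inner_smul_right, ← mul_assoc, map_inv₀, Complex.conj_ofReal, hs]
  have h := re_sum_inner_nonneg_of_sum_eq (fun a => ((√c : ℝ) : ℂ)⁻¹ • T a)
    (fun a b => ((hcomm a b).smul_left _).smul_right _)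
    (fun x y => by simp only [key, ← Finset.mul_sum, hT, inv_mul_cancel_left₀ hc']) ξ
  simp only [key, ← Finset.mul_sum] at h
  rw [← Complex.ofReal_inv, Complex.re_ofReal_mul] at h
  exact nonneg_of_mul_nonneg_right h (inv_pos.mpr hc)

end Positivity

section Extension

/-- A pre-Hilbert space on which a tuple `A` has formal adjoints `D` satisfying the spherical
unitary relations completes to a spherical unitary extension. -/
theorem nonempty_extension_of_preHilbert {H : Type u} [NormedAddCommGroup H]
    [InnerProductSpace ℂ H] [CompleteSpace H] {d : ℕ} (S : Fin d → H →L[ℂ] H)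
    {E : Type u} [SeminormedAddCommGroup E] [InnerProductSpace ℂ E]
    (A D : Fin d → E →ₗ[ℂ] E) (hAD : ∀ k x y, inner ℂ (A k x) y = inner ℂ x (D k y))
    (hA : ∀ j k x, A j (A k x) = A k (A j x)) (hnormal : ∀ k x, A k (D k x) = D k (A k x))
    (hsum : ∀ x y, ∑ k, inner ℂ (A k x) (A k y) = inner ℂ x y)
    (J : H →ₗᵢ[ℂ] E) (hJ : ∀ k x, A k (J x) = J (S k x)) :
    Nonempty (SphericalUnitaryExtension S) := by
  have hAle (k : Fin d) (x : E) : ‖A k x‖ ≤ 1 * ‖x‖ := by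
    have h := hsum x x
    simp only [inner_self_eq_norm_sq_to_K] at h
    have h' : ∑ k, ‖A k x‖ ^ 2 = ‖x‖ ^ 2 := by exact_mod_cast h
    rw [one_mul, ← sq_le_sq₀ (norm_nonneg _) (norm_nonneg _), ← h']
    exact Finset.single_le_sum (f := fun k => ‖A k x‖ ^ 2) (fun _ _ => sq_nonneg _)
      (Finset.mem_univ k)
  have hDle (k : Fin d) (x : E) : ‖D k x‖ ≤ 1 * ‖x‖ := by
    rcases (norm_nonneg (D k x)).eq_or_lt with h0 | h0
    · rw [← h0]; positivity
    · refine le_of_mul_le_mul_left ?_ h0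
      calc ‖D k x‖ * ‖D k x‖ = ‖inner ℂ (D k x) (D k x)‖ := by
            simp [inner_self_eq_norm_sq_to_K, pow_two]
        _ = ‖inner ℂ (A k (D k x)) x‖ := by rw [hAD]
        _ ≤ ‖A k (D k x)‖ * ‖x‖ := norm_inner_le_norm _ _
        _ ≤ ‖D k x‖ * (1 * ‖x‖) := by
            rw [one_mul]
            gcongr
            simpa using hAle k (D k x)
  let A' (k : Fin d) : E →L[ℂ] E := (A k).mkContinuous 1 (hAle k)
  let D' (k : Fin d) : E →L[ℂ] E := (D k).mkContinuous 1 (hDle k)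
  let U (k : Fin d) := (A' k).completion
  have hUc (k : Fin d) (x : E) : U k x = (A k x : UniformSpace.Completion E) :=
    (A' k).completion_apply_coe x
  have hVc (k : Fin d) (x : E) : (D' k).completion x = (D k x : UniformSpace.Completion E) :=
    (D' k).completion_apply_coe x
  have hadj (k : Fin d) : (D' k).completion = adjoint (U k) := by
    rw [eq_adjoint_iff]
    intro x y
    refine UniformSpace.Completion.induction_on₂ x y
      (isClosed_eq (by fun_prop) (by fun_prop)) fun a b => ?_
    rw [hVc, hUc, UniformSpace.Completion.inner_coe, UniformSpace.Completion.inner_coe,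
      ← inner_conj_symm, ← hAD, inner_conj_symm]
  have hext {f g : UniformSpace.Completion E →L[ℂ] UniformSpace.Completion E}
      (h : ∀ x : E, f x = g x) : f = g := by
    ext x
    exact UniformSpace.Completion.induction_on x (isClosed_eq f.continuous g.continuous) h
  have hN (k : Fin d) : U k ∘L adjoint (U k) = adjoint (U k) ∘L U k := by
    refine hext fun x => ?_
    simp only [← hadj, ContinuousLinearMap.comp_apply, hUc, hVc, hnormal]
  refine ⟨⟨UniformSpace.Completion E, UniformSpace.Completion.toComplₗᵢ.comp J, U,
    ⟨?_, hN, ?_⟩, ?_⟩⟩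
  · intro j k
    refine hext fun x => ?_
    simp only [mul_apply_eq_comp, hUc, hA j k]
  · simp only [hN]
    ext x
    refine ext_inner_left ℂ fun y => ?_
    simp only [sum_apply, ContinuousLinearMap.comp_apply, inner_sum,
      adjoint_inner_right, one_apply_eq_self]
    refine UniformSpace.Completion.induction_on₂ y x
      (isClosed_eq (by fun_prop) (by fun_prop)) fun a b => ?_
    simp only [hUc, UniformSpace.Completion.inner_coe, hsum]
  · intro k ξ
    simp [hUc, hJ]

end Extension

section Words

variable {H : Type*} [NormedAddCommGroup H] [InnerProductSpace ℂ H] {d : ℕ}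

/-- The product of the operators `S k` along a word. -/
def wordProd (S : Fin d → H →L[ℂ] H) (w : List (Fin d)) : H →L[ℂ] H := (w.map S).prod

theorem wordProd_nil (S : Fin d → H →L[ℂ] H) (x : H) : wordProd S [] x = x := rfl

theorem wordProd_cons (S : Fin d → H →L[ℂ] H) (k : Fin d) (w : List (Fin d)) (x : H) :
    wordProd S (k :: w) x = S k (wordProd S w x) := by
  simp [wordProd]

theorem commute_wordProd (S : Fin d → H →L[ℂ] H) (hcomm : ∀ i j, Commute (S i) (S j))
    (v w : List (Fin d)) : Commute (wordProd S v) (wordProd S w) := by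
  refine Commute.list_prod_left _ _ fun a ha => Commute.list_prod_right _ _ fun b hb => ?_
  obtain ⟨i, -, rfl⟩ := List.mem_map.mp ha
  obtain ⟨j, -, rfl⟩ := List.mem_map.mp hb
  exact hcomm i j

/-- The words of length at most `m`. -/
def wordsUpTo (d : ℕ) : ℕ → Finset (List (Fin d))
  | 0 => {[]}
  | m + 1 => insert [] ((Finset.univ ×ˢ wordsUpTo d m).image fun p => p.1 :: p.2)

theorem mem_wordsUpTo {m : ℕ} {w : List (Fin d)} (h : w.length ≤ m) : w ∈ wordsUpTo d m := by
  induction m generalizing w with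
  | zero => simpa [wordsUpTo] using h
  | succ m ih =>
    cases w with
    | nil => simp [wordsUpTo]
    | cons k w => simpa [wordsUpTo] using ih (by simpa using h)

theorem sum_wordsUpTo_inner (S : Fin d → H →L[ℂ] H)
    (hS : ∀ x y, ∑ k, inner ℂ (S k x) (S k y) = inner ℂ x y) (m : ℕ) (x y : H) :
    ∑ w ∈ wordsUpTo d m, inner ℂ (wordProd S w x) (wordProd S w y) =
      ((m + 1 : ℝ) : ℂ) * inner ℂ x y := by
  induction m with
  | zero => simp [wordsUpTo, wordProd_nil]
  | succ m ih =>
    rw [wordsUpTo, Finset.sum_insert (by simp), Finset.sum_image (by simp +contextual),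
      Finset.sum_product_right]
    simp only [wordProd_cons, wordProd_nil, hS, ih]
    push_cast
    ring

theorem re_finsuppSum_inner_nonneg (S : Fin d → H →L[ℂ] H)
    (hcomm : ∀ i j, Commute (S i) (S j))
    (hS : ∀ x y, ∑ k, inner ℂ (S k x) (S k y) = inner ℂ x y) (ξ : List (Fin d) →₀ H) :
    0 ≤ (ξ.sum fun b x => ξ.sum fun a y =>
      inner ℂ (wordProd S a x) (wordProd S b y)).re := by
  set m := ξ.support.sup List.length
  have hsub : ξ.support ⊆ wordsUpTo d m := fun w hw => mem_wordsUpTo (Finset.le_sup hw)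
  have h := re_sum_inner_nonneg (A := wordsUpTo d m) (fun a => wordProd S a)
    (fun a b => commute_wordProd S hcomm a b) (c := m + 1) (by positivity)
    (fun x y => by
      rw [← sum_wordsUpTo_inner S hS, ← Finset.sum_coe_sort (wordsUpTo d m)])
    (fun a => ξ a)
  convert h using 2
  rw [Finset.sum_comm, Finsupp.sum_of_support_subset _ hsub _ (by simp),
    ← Finset.sum_coe_sort (wordsUpTo d m)]
  refine Finset.sum_congr rfl fun b _ => ?_
  rw [Finsupp.sum_of_support_subset _ hsub _ (by simp), ← Finset.sum_coe_sort (wordsUpTo d m)]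

/-- The semi-inner product on finitely supported families `ξ`, thought of as `∑ U*ʷ ξ_w`. -/
@[reducible]
def wordCore (S : Fin d → H →L[ℂ] H) (hcomm : ∀ i j, Commute (S i) (S j))
    (hS : ∀ x y, ∑ k, inner ℂ (S k x) (S k y) = inner ℂ x y) :
    PreInnerProductSpace.Core ℂ (List (Fin d) →₀ H) where
  inner ξ η := ξ.sum fun b x => η.sum fun a y => inner ℂ (wordProd S a x) (wordProd S b y)
  conj_inner_symm ξ η := by
    simp only [Finsupp.sum, map_sum, inner_conj_symm]
    exact Finset.sum_comm
  re_inner_nonneg := re_finsuppSum_inner_nonneg S hcomm hS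
  add_left ξ η ζ := by
    refine Finsupp.sum_add_index' (by simp) fun b x y => ?_
    simp only [map_add, inner_add_left, Finsupp.sum_add]
  smul_left ξ η r := by
    rw [Finsupp.sum_smul_index' (by simp)]
    simp only [map_smul, inner_smul_left, Finsupp.sum, Finset.mul_sum]

end Words

open ContinuousLinearMap in
/-- Every spherical isometry (a commuting tuple with `∑ Sₖ* Sₖ = 1`) extends to a
spherical unitary (Athavale). -/
theorem sphericalIsometry_extends_to_sphericalUnitary
    {H : Type u} [NormedAddCommGroup H] [InnerProductSpace ℂ H] [CompleteSpace H]
    {d : ℕ} (S : Fin d → H →L[ℂ] H) (hcomm : Commuting S)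
    (hiso : ∑ k, adjoint (S k) ∘L S k = 1) :
    Nonempty (SphericalUnitaryExtension S) := by
  have hS (x y : H) : ∑ k, inner ℂ (S k x) (S k y) = inner ℂ x y := by
    have h := congrArg (fun T : H →L[ℂ] H => inner ℂ x (T y)) hiso
    simpa [inner_sum, adjoint_inner_right] using h
  have app (i j : Fin d) (x : H) : S i (S j x) = S j (S i x) :=
    DFunLike.congr_fun (hcomm i j) x
  have appw (k : Fin d) (w : List (Fin d)) (x : H) :
      wordProd S w (S k x) = S k (wordProd S w x) := by
    simpa [wordProd] using DFunLike.congr_fun (commute_wordProd S hcomm w [k]) x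
  let c := wordCore S hcomm hS
  let _ : SeminormedAddCommGroup (List (Fin d) →₀ H) :=
    InnerProductSpace.Core.toSeminormedAddCommGroup (𝕜 := ℂ) (c := c)
  let _ : InnerProductSpace ℂ (List (Fin d) →₀ H) := InnerProductSpace.ofCore c
  have inner_def (ξ η : List (Fin d) →₀ H) : inner ℂ ξ η = ξ.sum fun b x => η.sum fun a y =>
      inner ℂ (wordProd S a x) (wordProd S b y) := rfl
  let J : H →ₗᵢ[ℂ] (List (Fin d) →₀ H) := (Finsupp.lsingle []).isometryOfInner fun x y => by
    simp [inner_def, wordProd_nil]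
  refine nonempty_extension_of_preHilbert S
    (fun k => Finsupp.mapRange.linearMap (S k : H →ₗ[ℂ] H))
    (fun k => Finsupp.lmapDomain H ℂ (List.cons k)) ?_ ?_ ?_ ?_ J ?_
  · intro k ξ η
    simp only [inner_def, Finsupp.mapRange.linearMap_apply, Finsupp.lmapDomain_apply]
    rw [Finsupp.sum_mapRange_index (by simp)]
    refine Finsupp.sum_congr fun b _ => ?_
    rw [Finsupp.sum_mapDomain_index (by simp) (by simp)]
    simp [wordProd_cons, appw]
  · intro j k ξ
    ext w
    simp [app j k]
  · intro k ξ
    simp [Finsupp.mapDomain_mapRange]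
  · intro ξ η
    have step (k : Fin d) : inner ℂ (Finsupp.mapRange.linearMap (S k : H →ₗ[ℂ] H) ξ)
        (Finsupp.mapRange.linearMap (S k : H →ₗ[ℂ] H) η) = ξ.sum fun b x => η.sum fun a y =>
          inner ℂ (wordProd S a (S k x)) (wordProd S b (S k y)) := by
      simp only [inner_def, Finsupp.mapRange.linearMap_apply]
      rw [Finsupp.sum_mapRange_index (by simp)]
      refine Finsupp.sum_congr fun b _ => ?_
      rw [Finsupp.sum_mapRange_index (by simp)]
      rfl
    simp only [step, inner_def, Finsupp.sum]
    rw [Finset.sum_comm]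
    refine Finset.sum_congr rfl fun b _ => ?_
    rw [Finset.sum_comm]
    refine Finset.sum_congr rfl fun a _ => ?_
    simp only [appw, hS]
  · intro k x
    simp [J]

end RowCtr
end
end

section
/- Let T = (T_1,…,T_d) be a commuting row contraction on a complex Hilbert space H. Then there exist unique closed subspaces H_cnu and H_u of H, both reducing for T, such that H = H_cnu ⊕ H_u (orthogonal direct sum), the restricted tuple (T_1|_{H_cnu},…,T_d|_{H_cnu}) is completely non-unitary, and the restricted tuple (T_1|_{H_u},…,T_d|_{H_u}) is a spherical unitary on H_u. -/
noncomputable section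

open ContinuousLinearMap Filter

namespace RowCtr

open scoped InnerProductSpace

/-- `(Hc, Hu)` is an orthogonal decomposition `H = Hc ⊕ Hu` into closed reducing subspaces
such that `T` restricts to a completely non-unitary tuple on `Hc` and to a spherical unitary
on `Hu`. -/
def IsCnuSphericalDecomp {H : Type*} [NormedAddCommGroup H] [InnerProductSpace ℂ H]
    [CompleteSpace H] {d : ℕ} (T : Fin d → H →L[ℂ] H) (Hc Hu : Submodule ℂ H) : Prop :=
  ∃ (hc : IsClosed (Hc : Set H)) (_ : IsClosed (Hu : Set H)),
    (∀ x ∈ Hc, ∀ y ∈ Hu, ⟪x, y⟫_ℂ = 0) ∧ Hc ⊔ Hu = ⊤ ∧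
    ∃ (redc : Reduces T Hc) (_ : Reduces T Hu),
      (letI : CompleteSpace Hc := hc.completeSpace_coe
       IsCompletelyNonUnitary (restrictTuple T Hc redc.1)) ∧
      RestrictsToSphericalUnitary T Hu

section Restriction

variable {H : Type*} [NormedAddCommGroup H] [InnerProductSpace ℂ H] {d : ℕ}

lemma coe_restrictTuple (T : Fin d → H →L[ℂ] H) (N : Submodule ℂ H) (h : Invar T N)
    (k : Fin d) (x : N) : ((restrictTuple T N h k x : N) : H) = T k (x : H) := rfl

lemma Commuting.restrictTuple {T : Fin d → H →L[ℂ] H} (hT : Commuting T) {N : Submodule ℂ H}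
    (h : Invar T N) : Commuting (RowCtr.restrictTuple T N h) := by
  intro i j
  ext x
  exact congrArg (fun f : H →L[ℂ] H => f (x : H)) (hT i j).eq

variable [CompleteSpace H]

/-- The adjoint of the restriction to an invariant subspace is the compression of the adjoint. -/
lemma inner_adjoint_restrictCLM (f : H →L[ℂ] H) (N : Submodule ℂ H) [CompleteSpace N]
    (h : ∀ x ∈ N, f x ∈ N) (x y : N) :
    ⟪((adjoint (restrictCLM f N h) x : N) : H), (y : H)⟫_ℂ = ⟪adjoint f (x : H), (y : H)⟫_ℂ := by
  rw [← Submodule.coe_inner, adjoint_inner_left, adjoint_inner_left]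
  rfl

lemma coe_adjoint_restrictCLM (f : H →L[ℂ] H) (N : Submodule ℂ H) [CompleteSpace N]
    (h : ∀ x ∈ N, f x ∈ N) (x : N) (hx : adjoint f (x : H) ∈ N) :
    ((adjoint (restrictCLM f N h) x : N) : H) = adjoint f (x : H) := by
  have key : adjoint (restrictCLM f N h) x = ⟨adjoint f (x : H), hx⟩ := by
    refine ext_inner_right ℂ fun y => ?_
    rw [Submodule.coe_inner, Submodule.coe_inner]
    exact inner_adjoint_restrictCLM f N h x y
  rw [key]

lemma Reduces.coe_adjoint_restrictTuple {T : Fin d → H →L[ℂ] H} {N : Submodule ℂ H}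
    [CompleteSpace N] (h : Reduces T N) (k : Fin d) (x : N) :
    ((adjoint (restrictTuple T N h.1 k) x : N) : H) = adjoint (T k) (x : H) :=
  coe_adjoint_restrictCLM _ _ _ _ (h.2 k x x.2)

/-- The closed subspace of all vectors at which every `T k` is normal and `∑ Tₖ Tₖ*` acts as
the identity. -/
def sphericalKernel (T : Fin d → H →L[ℂ] H) : Submodule ℂ H :=
  (⨅ k, (T k ∘L adjoint (T k) - adjoint (T k) ∘L T k).ker) ⊓
    (∑ k, T k ∘L adjoint (T k) - 1).ker

lemma mem_sphericalKernel {T : Fin d → H →L[ℂ] H} {x : H} :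
    x ∈ sphericalKernel T ↔
      (∀ k, T k (adjoint (T k) x) = adjoint (T k) (T k x)) ∧
        ∑ k, T k (adjoint (T k) x) = x := by
  simp [sphericalKernel, sub_eq_zero]

lemma isClosed_sphericalKernel (T : Fin d → H →L[ℂ] H) :
    IsClosed (sphericalKernel T : Set H) := by
  rw [sphericalKernel, Submodule.coe_inf, Submodule.coe_iInf]
  exact (isClosed_iInter fun k => ContinuousLinearMap.isClosed_ker _).inter
    (ContinuousLinearMap.isClosed_ker _)

lemma sum_norm_adjoint_sq (T : Fin d → H →L[ℂ] H) (x : H) :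
    ∑ k, ‖adjoint (T k) x‖ ^ 2 = RCLike.re ⟪∑ k, T k (adjoint (T k) x), x⟫_ℂ := by
  rw [sum_inner, map_sum]
  refine Finset.sum_congr rfl fun k _ => ?_
  rw [← adjoint_inner_right, inner_self_eq_norm_sq]

lemma IsRowContraction.sum_norm_adjoint_sq_le {T : Fin d → H →L[ℂ] H} (hT : IsRowContraction T)
    (x : H) : ∑ k, ‖adjoint (T k) x‖ ^ 2 ≤ ‖x‖ ^ 2 := by
  have h := hT.2.re_inner_nonneg_left x
  rw [sub_apply, inner_sub_left, map_sub, one_apply_eq_self, inner_self_eq_norm_sq,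
    sum_apply] at h
  rw [sum_norm_adjoint_sq]
  simpa [sum_inner] using h

lemma isRowContraction_of_sum_norm_adjoint_sq_le {T : Fin d → H →L[ℂ] H} (hT : Commuting T)
    (h : ∀ x, ∑ k, ‖adjoint (T k) x‖ ^ 2 ≤ ‖x‖ ^ 2) : IsRowContraction T := by
  refine ⟨hT, ContinuousLinearMap.isPositive_def'.2 ⟨?_, fun x => ?_⟩⟩
  · refine (IsSelfAdjoint.one _).sub ?_
    exact isSelfAdjoint_sum _ fun k _ => IsSelfAdjoint.mul_star_self (T k)
  · have hx := h x
    rw [sum_norm_adjoint_sq] at hx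
    rw [reApplyInnerSelf_apply, sub_apply, inner_sub_left, map_sub, one_apply_eq_self,
      inner_self_eq_norm_sq, sum_apply]
    simpa [sum_inner] using hx

lemma IsRowContraction.restrictTuple {T : Fin d → H →L[ℂ] H} (hT : IsRowContraction T)
    {N : Submodule ℂ H} [CompleteSpace N] (h : Reduces T N) :
    IsRowContraction (RowCtr.restrictTuple T N h.1) := by
  refine isRowContraction_of_sum_norm_adjoint_sq_le (hT.1.restrictTuple h.1) fun x => ?_
  simpa only [Submodule.coe_norm, h.coe_adjoint_restrictTuple] using
    hT.sum_norm_adjoint_sq_le (x : H)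

/-- An invariant subspace on which a row contraction is a spherical unitary is reducing. -/
lemma IsRowContraction.reduces_of_isSphericalUnitary {T : Fin d → H →L[ℂ] H}
    (hT : IsRowContraction T) {N : Submodule ℂ H} [CompleteSpace N] (hi : Invar T N)
    (hU : IsSphericalUnitary (RowCtr.restrictTuple T N hi)) : Reduces T N := by
  refine ⟨hi, fun k x hx => ?_⟩
  set S := RowCtr.restrictTuple T N hi with hS
  let u : Fin d → H := fun k => ((adjoint (S k) ⟨x, hx⟩ : N) : H)
  have pyth : ∀ k, ‖adjoint (T k) x‖ ^ 2 = ‖u k‖ ^ 2 + ‖adjoint (T k) x - u k‖ ^ 2 := by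
    intro k
    have horth : ⟪u k, adjoint (T k) x - u k⟫_ℂ = 0 := by
      rw [← inner_eq_zero_symm, inner_sub_left, sub_eq_zero]
      exact (inner_adjoint_restrictCLM (T k) N (hi k) ⟨x, hx⟩ _).symm
    have := norm_add_sq_eq_norm_sq_add_norm_sq_of_inner_eq_zero _ _ horth
    rw [add_sub_cancel] at this
    simpa only [sq] using this
  have hsum : ∑ k, ‖u k‖ ^ 2 = ‖x‖ ^ 2 := by
    have h1 := sum_norm_adjoint_sq S ⟨x, hx⟩
    have h2 : ∑ k, S k (adjoint (S k) ⟨x, hx⟩) = ⟨x, hx⟩ := by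
      simpa [sum_apply] using
        congrArg (fun f : N →L[ℂ] N => f ⟨x, hx⟩) hU.2.2
    rw [h2, inner_self_eq_norm_sq] at h1
    exact h1
  have hle := hT.sum_norm_adjoint_sq_le x
  simp only [pyth, Finset.sum_add_distrib, hsum] at hle
  have hzero : ∑ k, ‖adjoint (T k) x - u k‖ ^ 2 = 0 :=
    le_antisymm (by linarith) (Finset.sum_nonneg fun _ _ => sq_nonneg _)
  have hk := (Finset.sum_eq_zero_iff_of_nonneg fun _ _ => sq_nonneg _).1 hzero k
    (Finset.mem_univ k)
  have heq : adjoint (T k) x = u k := by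
    simpa [sub_eq_zero] using hk
  rw [heq]
  exact (adjoint (S k) ⟨x, hx⟩).2

lemma Reduces.isSphericalUnitary_iff {T : Fin d → H →L[ℂ] H} (hT : Commuting T)
    {N : Submodule ℂ H} [CompleteSpace N] (h : Reduces T N) :
    IsSphericalUnitary (RowCtr.restrictTuple T N h.1) ↔ N ≤ sphericalKernel T := by
  constructor
  · intro hU x hx
    refine mem_sphericalKernel.2 ⟨fun k => ?_, ?_⟩
    · have := congrArg (fun f : N →L[ℂ] N => ((f ⟨x, hx⟩ : N) : H)) (hU.2.1 k)
      simpa [coe_restrictTuple, h.coe_adjoint_restrictTuple] using this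
    · have := congrArg (fun f : N →L[ℂ] N => ((f ⟨x, hx⟩ : N) : H)) hU.2.2
      simpa [coe_restrictTuple, h.coe_adjoint_restrictTuple,
        sum_apply] using this
  · intro hN
    refine ⟨hT.restrictTuple h.1, fun k => ?_, ?_⟩
    · ext x
      simpa [coe_restrictTuple, h.coe_adjoint_restrictTuple] using
        (mem_sphericalKernel.1 (hN x.2)).1 k
    · ext x
      simpa [coe_restrictTuple, h.coe_adjoint_restrictTuple,
        sum_apply] using (mem_sphericalKernel.1 (hN x.2)).2

lemma IsRowContraction.restrictsToSphericalUnitary_iff {T : Fin d → H →L[ℂ] H}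
    (hT : IsRowContraction T) {N : Submodule ℂ H} :
    RestrictsToSphericalUnitary T N ↔
      IsClosed (N : Set H) ∧ Reduces T N ∧ N ≤ sphericalKernel T := by
  constructor
  · rintro ⟨hc, hi, hU⟩
    have : CompleteSpace N := hc.completeSpace_coe
    have hr := hT.reduces_of_isSphericalUnitary hi hU
    exact ⟨hc, hr, (hr.isSphericalUnitary_iff hT.1).1 hU⟩
  · rintro ⟨hc, hr, hN⟩
    have : CompleteSpace N := hc.completeSpace_coe
    exact ⟨hc, hr.1, (hr.isSphericalUnitary_iff hT.1).2 hN⟩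

lemma Reduces.inf {T : Fin d → H →L[ℂ] H} {M N : Submodule ℂ H} (hM : Reduces T M)
    (hN : Reduces T N) : Reduces T (M ⊓ N) :=
  ⟨fun k x hx => ⟨hM.1 k x hx.1, hN.1 k x hx.2⟩, fun k x hx => ⟨hM.2 k x hx.1, hN.2 k x hx.2⟩⟩

lemma Reduces.orthogonal {T : Fin d → H →L[ℂ] H} {N : Submodule ℂ H} (h : Reduces T N) :
    Reduces T Nᗮ := by
  refine ⟨fun k x hx y hy => ?_, fun k x hx y hy => ?_⟩
  · rw [← adjoint_inner_left]
    exact hx _ (h.2 k y hy)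
  · rw [adjoint_inner_right]
    exact hx _ (h.1 k y hy)

lemma Reduces.topologicalClosure {T : Fin d → H →L[ℂ] H} {N : Submodule ℂ H}
    (h : Reduces T N) : Reduces T N.topologicalClosure :=
  ⟨fun k _ hx => map_mem_closure (T k).continuous hx (h.1 k),
    fun k _ hx => map_mem_closure (adjoint (T k)).continuous hx (h.2 k)⟩

lemma reduces_sSup {T : Fin d → H →L[ℂ] H} {s : Set (Submodule ℂ H)}
    (h : ∀ N ∈ s, Reduces T N) : Reduces T (sSup s) := by
  refine ⟨fun k => ?_, fun k => ?_⟩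
  · change sSup s ≤ (sSup s).comap (T k).toLinearMap
    exact sSup_le fun N hN x hx => le_sSup hN ((h N hN).1 k x hx)
  · change sSup s ≤ (sSup s).comap (adjoint (T k)).toLinearMap
    exact sSup_le fun N hN x hx => le_sSup hN ((h N hN).2 k x hx)

/-- The largest closed reducing subspace on which `T` is a spherical unitary. -/
def sphericalPart (T : Fin d → H →L[ℂ] H) : Submodule ℂ H :=
  (sSup {N : Submodule ℂ H | Reduces T N ∧ N ≤ sphericalKernel T}).topologicalClosure

lemma isClosed_sphericalPart (T : Fin d → H →L[ℂ] H) : IsClosed (sphericalPart T : Set H) :=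
  Submodule.isClosed_topologicalClosure _

lemma reduces_sphericalPart (T : Fin d → H →L[ℂ] H) : Reduces T (sphericalPart T) :=
  (reduces_sSup fun _ hN => hN.1).topologicalClosure

lemma sphericalPart_le (T : Fin d → H →L[ℂ] H) : sphericalPart T ≤ sphericalKernel T :=
  Submodule.topologicalClosure_minimal _ (sSup_le fun _ hN => hN.2) (isClosed_sphericalKernel T)

lemma le_sphericalPart {T : Fin d → H →L[ℂ] H} {N : Submodule ℂ H} (hr : Reduces T N)
    (hN : N ≤ sphericalKernel T) : N ≤ sphericalPart T :=
  (le_sSup (show N ∈ {N : Submodule ℂ H | Reduces T N ∧ N ≤ sphericalKernel T} from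
    ⟨hr, hN⟩)).trans (Submodule.le_topologicalClosure _)

lemma Reduces.mem_sphericalKernel_restrictTuple {T : Fin d → H →L[ℂ] H} {N : Submodule ℂ H}
    [CompleteSpace N] (h : Reduces T N) (x : N) :
    x ∈ sphericalKernel (RowCtr.restrictTuple T N h.1) ↔ (x : H) ∈ sphericalKernel T := by
  simp only [mem_sphericalKernel, Subtype.ext_iff, coe_restrictTuple,
    h.coe_adjoint_restrictTuple, Submodule.coe_sum]

/-- The restriction of a row contraction to a reducing subspace `N` is completely non-unitary
exactly when `N` meets the spherical part trivially. -/
lemma Reduces.isCompletelyNonUnitary_iff {T : Fin d → H →L[ℂ] H} (hT : IsRowContraction T)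
    {N : Submodule ℂ H} [CompleteSpace N] (h : Reduces T N) :
    IsCompletelyNonUnitary (RowCtr.restrictTuple T N h.1) ↔ sphericalPart T ⊓ N = ⊥ := by
  constructor
  · intro hcnu
    have hr : Reduces T (sphericalPart T ⊓ N) := (reduces_sphericalPart T).inf h
    have hbot := hcnu ((sphericalPart T).comap N.subtype)
      ((hT.restrictTuple h).restrictsToSphericalUnitary_iff.2
        ⟨(isClosed_sphericalPart T).preimage continuous_subtype_val,
          ⟨fun k x hx => (reduces_sphericalPart T).1 k _ hx, fun k x hx => ?_⟩,
          fun x hx => (h.mem_sphericalKernel_restrictTuple x).2 (sphericalPart_le T hx)⟩)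
    · rw [eq_bot_iff]
      rintro x ⟨hxs, hxN⟩
      have : (⟨x, hxN⟩ : N) ∈ (sphericalPart T).comap N.subtype := hxs
      rw [hbot, Submodule.mem_bot] at this
      exact congrArg Subtype.val this
    · change ((adjoint (RowCtr.restrictTuple T N h.1 k) x : N) : H) ∈ sphericalPart T
      rw [h.coe_adjoint_restrictTuple]
      exact (reduces_sphericalPart T).2 k _ hx
  · intro hbot M hM
    obtain ⟨-, hr, hle⟩ := (hT.restrictTuple h).restrictsToSphericalUnitary_iff.1 hM
    have hmap : M.map N.subtype ≤ sphericalPart T := by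
      refine le_sphericalPart ⟨?_, ?_⟩ ?_
      · rintro k _ ⟨x, hx, rfl⟩
        exact ⟨_, hr.1 k x hx, rfl⟩
      · rintro k _ ⟨x, hx, rfl⟩
        exact ⟨_, hr.2 k x hx, h.coe_adjoint_restrictTuple k x⟩
      · rintro _ ⟨x, hx, rfl⟩
        exact (h.mem_sphericalKernel_restrictTuple x).1 (hle hx)
    rw [eq_bot_iff]
    intro x hx
    have hx0 : (x : H) ∈ sphericalPart T ⊓ N := ⟨hmap ⟨x, hx, rfl⟩, x.2⟩
    rw [hbot, Submodule.mem_bot] at hx0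
    exact Subtype.ext hx0

end Restriction

/-- Every commuting row contraction decomposes uniquely as an orthogonal direct
sum of a completely non-unitary part and a spherical unitary part. -/
theorem exists_unique_cnu_sphericalUnitary_decomposition
    {H : Type*} [NormedAddCommGroup H] [InnerProductSpace ℂ H] [CompleteSpace H]
    {d : ℕ} (T : Fin d → H →L[ℂ] H) (hT : IsRowContraction T) :
    ∃! p : Submodule ℂ H × Submodule ℂ H, IsCnuSphericalDecomp T p.1 p.2 := by
  refine ⟨((sphericalPart T)ᗮ, sphericalPart T), ?_, ?_⟩
  · have hu := isClosed_sphericalPart T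
    have hr := reduces_sphericalPart T
    have : CompleteSpace (sphericalPart T) := hu.completeSpace_coe
    refine ⟨Submodule.isClosed_orthogonal _, hu,
      fun x hx y hy => Submodule.inner_left_of_mem_orthogonal hy hx, ?_, hr.orthogonal, hr,
      (hr.orthogonal.isCompletelyNonUnitary_iff hT).2 (Submodule.inf_orthogonal_eq_bot _),
      hT.restrictsToSphericalUnitary_iff.2 ⟨hu, hr, sphericalPart_le T⟩⟩
    rw [sup_comm]
    exact Submodule.sup_orthogonal_of_hasOrthogonalProjection
  · rintro ⟨Hc, Hu⟩ ⟨hc, hu, horth, htop, redc, redu, hcnu, hU⟩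
    dsimp only at *
    have : CompleteSpace Hc := hc.completeSpace_coe
    have : CompleteSpace Hu := hu.completeSpace_coe
    have hcperp : Hc = Huᗮ := by
      refine le_antisymm (fun x hx => (Submodule.mem_orthogonal' _ _).2 (horth x hx)) ?_
      intro x hx
      obtain ⟨y, hy, z, hz, rfl⟩ := Submodule.mem_sup.1 (htop ▸ Submodule.mem_top : x ∈ Hc ⊔ Hu)
      have hzz : ⟪z, y + z⟫_ℂ = 0 := hx z hz
      rw [inner_add_right, inner_eq_zero_symm.1 (horth y hy z hz), zero_add,
        inner_self_eq_zero] at hzz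
      simpa [hzz] using hy
    have hle : Hu ≤ sphericalPart T :=
      le_sphericalPart redu (hT.restrictsToSphericalUnitary_iff.1 hU).2.2
    have hbot := (redc.isCompletelyNonUnitary_iff hT).1 hcnu
    have huEq : Hu = sphericalPart T := by
      refine le_antisymm hle fun x hx => ?_
      obtain ⟨y, hy, z, hz, rfl⟩ := Submodule.mem_sup.1 (htop ▸ Submodule.mem_top : x ∈ Hc ⊔ Hu)
      have hy0 : y ∈ sphericalPart T ⊓ Hc :=
        ⟨by simpa using (sphericalPart T).sub_mem hx (hle hz), hy⟩
      rw [hbot, Submodule.mem_bot] at hy0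
      simpa [hy0] using hz
    rw [hcperp, huEq]

end RowCtr
end
end

section
/- Let S = (S_1,…,S_d) be a d-tuple of pairwise commuting bounded linear operators on a complex Hilbert space H satisfying ∑_{k=1}^d S_k* S_k = I and ∑_{k=1}^d S_k S_k* = I. Then each S_k is a normal operator; consequently S is a spherical unitary. -/
noncomputable section

open ContinuousLinearMap Filter

namespace RowCtr

/-- In a C⋆-algebra, a commuting family `a` with `∑ aₖ⋆ aₖ = 1` and `∑ aₖ aₖ⋆ = 1`
is doubly commuting. -/
theorem commute_star_of_sum_star_mul_self_eq_one {A ι : Type*} [CStarAlgebra A]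
    [PartialOrder A] [StarOrderedRing A] [Fintype ι] (a : ι → A)
    (hcomm : ∀ i j, Commute (a i) (a j))
    (h1 : ∑ k, star (a k) * a k = 1) (h2 : ∑ k, a k * star (a k) = 1) (j k : ι) :
    Commute (star (a j)) (a k) := by
  let D : ι → ι → A := fun j k => star (a j) * a k - a k * star (a j)
  have expand (j k : ι) : star (D j k) * D j k =
      star (a k) * (a j * star (a j)) * a k - (star (a k) * a k) * (a j * star (a j))
        - (a j * star (a j)) * (star (a k) * a k)
        + a j * (star (a k) * a k) * star (a j) := by
    have e1 : a j * (a k * star (a j)) = a k * (a j * star (a j)) := by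
      rw [← mul_assoc, (hcomm j k).eq, mul_assoc]
    have e2 : star (a k) * (star (a j) * a k) = star (a j) * (star (a k) * a k) := by
      rw [← mul_assoc, ((hcomm k j).star_star).eq, mul_assoc]
    simp only [D, star_sub, star_mul, star_star, sub_mul, mul_sub, mul_assoc, e1, e2]
    abel
  have sum_zero : ∑ j, ∑ k, star (D j k) * D j k = 0 := by
    have t1 : ∑ j, ∑ k, star (a k) * (a j * star (a j)) * a k = 1 := by
      rw [Finset.sum_comm]
      simp only [← Finset.sum_mul, ← Finset.mul_sum, h2, mul_one, h1]
    simp only [expand, Finset.sum_add_distrib, Finset.sum_sub_distrib, t1]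
    simp only [← Finset.sum_mul, ← Finset.mul_sum, h1, h2, one_mul, mul_one]
    abel
  have row_zero := (Finset.sum_eq_zero_iff_of_nonneg fun j _ =>
    Finset.sum_nonneg fun k _ => star_mul_self_nonneg (D j k)).1 sum_zero j (Finset.mem_univ j)
  have entry_zero := (Finset.sum_eq_zero_iff_of_nonneg fun k _ =>
    star_mul_self_nonneg (D j k)).1 row_zero k (Finset.mem_univ k)
  exact sub_eq_zero.1 (CStarRing.star_mul_self_eq_zero_iff _ |>.1 entry_zero)

open ContinuousLinearMap in
/-- If `S` is a commuting tuple with `∑ Sₖ* Sₖ = 1` and `∑ Sₖ Sₖ* = 1`,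
then each `Sₖ` is normal, and hence `S` is a spherical unitary. -/
theorem sphericalIsometry_biisometry_is_sphericalUnitary
    {H : Type*} [NormedAddCommGroup H] [InnerProductSpace ℂ H] [CompleteSpace H]
    {d : ℕ} (S : Fin d → H →L[ℂ] H) (hcomm : Commuting S)
    (h1 : ∑ k, adjoint (S k) ∘L S k = 1) (h2 : ∑ k, S k ∘L adjoint (S k) = 1) :
    (∀ k, S k ∘L adjoint (S k) = adjoint (S k) ∘L S k) ∧ IsSphericalUnitary S := by
  have normal (k) : S k ∘L adjoint (S k) = adjoint (S k) ∘L S k :=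
    (commute_star_of_sum_star_mul_self_eq_one S hcomm h1 h2 k k).eq.symm
  exact ⟨normal, hcomm, normal, h2⟩

end RowCtr
end
end
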